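/- For every α with 0 < α < 1/2 there is a constant C_α > 0 (depending also on the dyadic partition) such that for every smooth divergence-free vector field u : 𝕋² → ℝ², Σ_{k≥−1} 2^{4k} |⟨Δ^v_k(u·∇u), Δ^v_k u⟩_{L²}| ≤ α ‖∂₁u‖²_{H^{0,2}} + C_α (1 + ‖u‖²_{H^{0,1}})(1 + ‖u‖²_{H^{1,1}}) ‖u‖²_{H^{0,2}}. -/

import Mathlib

open MeasureTheory Real Complex Filter Set

noncomputable section

namespace Aniso

/-- Fundamental domain `(0, 2π]` for the circle of circumference `2π`. -/
def I2pi : Set ℝ := Set.Ioc 0 (2 * π)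

/-- Fundamental domain for the 2-torus `𝕋² = (ℝ/2πℤ)²`. -/
def Q2 : Set (ℝ × ℝ) := I2pi ×ˢ I2pi

/-- Integral over the torus of a real function. -/
def tintR (f : ℝ × ℝ → ℝ) : ℝ := ∫ x in Q2, f x

/-- Smoothness of a scalar field. -/
def Smooth (f : ℝ × ℝ → ℝ) : Prop := ContDiff ℝ (⊤ : ℕ∞) f

/-- Smoothness of a vector field. -/
def SmoothV (u : ℝ × ℝ → ℝ × ℝ) : Prop := ContDiff ℝ (⊤ : ℕ∞) u

/-- `2π`-periodicity in each variable: this encodes being a function on the torus. -/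
def Per (f : ℝ × ℝ → ℝ) : Prop :=
  (∀ x : ℝ × ℝ, f (x.1 + 2 * π, x.2) = f x) ∧ (∀ x : ℝ × ℝ, f (x.1, x.2 + 2 * π) = f x)

def PerV (u : ℝ × ℝ → ℝ × ℝ) : Prop :=
  Per (fun x => (u x).1) ∧ Per (fun x => (u x).2)

/-- Partial derivative in the horizontal variable `x₁`. -/
def pd1 (f : ℝ × ℝ → ℝ) : ℝ × ℝ → ℝ := fun x => fderiv ℝ f x (1, 0)

/-- Partial derivative in the vertical variable `x₂`. -/
def pd2 (f : ℝ × ℝ → ℝ) : ℝ × ℝ → ℝ := fun x => fderiv ℝ f x (0, 1)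

def comp1 (u : ℝ × ℝ → ℝ × ℝ) : ℝ × ℝ → ℝ := fun x => (u x).1
def comp2 (u : ℝ × ℝ → ℝ × ℝ) : ℝ × ℝ → ℝ := fun x => (u x).2

def pd1V (u : ℝ × ℝ → ℝ × ℝ) : ℝ × ℝ → ℝ × ℝ := fun x => (pd1 (comp1 u) x, pd1 (comp2 u) x)
def pd2V (u : ℝ × ℝ → ℝ × ℝ) : ℝ × ℝ → ℝ × ℝ := fun x => (pd2 (comp1 u) x, pd2 (comp2 u) x)

/-- Divergence-free condition `∂₁u¹ + ∂₂u² = 0`. -/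
def DivFree (u : ℝ × ℝ → ℝ × ℝ) : Prop :=
  ∀ x, pd1 (comp1 u) x + pd2 (comp2 u) x = 0

/-- The transport term `u·∇v`, with components `u¹∂₁vʲ + u²∂₂vʲ`. -/
def advect (u v : ℝ × ℝ → ℝ × ℝ) : ℝ × ℝ → ℝ × ℝ := fun x =>
  ((u x).1 * pd1 (comp1 v) x + (u x).2 * pd2 (comp1 v) x,
   (u x).1 * pd1 (comp2 v) x + (u x).2 * pd2 (comp2 v) x)

/-- L² inner product of real vector fields on the torus (summed over components). -/
def ipV (u v : ℝ × ℝ → ℝ × ℝ) : ℝ := tintR fun x => (u x).1 * (v x).1 + (u x).2 * (v x).2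

/-- The trilinear form `b(u,v,w) = ∫ (u·∇v)·w`. -/
def b3 (u v w : ℝ × ℝ → ℝ × ℝ) : ℝ := ipV (advect u v) w

/-- L² norm of a scalar function on the torus. -/
def L2 (f : ℝ × ℝ → ℝ) : ℝ := Real.sqrt (tintR fun x => f x ^ 2)

/-- L² norm of a vector field on the torus. -/
def L2V (u : ℝ × ℝ → ℝ × ℝ) : ℝ := Real.sqrt (tintR fun x => (u x).1 ^ 2 + (u x).2 ^ 2)

/-- Fourier coefficient of a complex-valued function on the torus. -/
def fcC (f : ℝ × ℝ → ℂ) (k : ℤ × ℤ) : ℂ :=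
  (1 / (2 * π) ^ 2 : ℂ) *
    ∫ x in Q2, f x * Complex.exp (-(Complex.I) * ((k.1 : ℂ) * (x.1 : ℂ) + (k.2 : ℂ) * (x.2 : ℂ)))

/-- Fourier coefficient of a real-valued function on the torus. -/
def fc (f : ℝ × ℝ → ℝ) (k : ℤ × ℤ) : ℂ := fcC (fun x => (f x : ℂ)) k

/-- Anisotropic Sobolev weight `(1+|k₁|²)^s (1+|k₂|²)^{s'}`. -/
def aw (s s' : ℝ) (k : ℤ × ℤ) : ℝ :=
  (1 + (k.1 : ℝ) ^ 2) ^ s * (1 + (k.2 : ℝ) ^ 2) ^ s'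

/-- Square of the anisotropic Sobolev norm `H^{s,s'}` of a scalar function. -/
def HSq (s s' : ℝ) (f : ℝ × ℝ → ℝ) : ℝ := ∑' k : ℤ × ℤ, aw s s' k * ‖fc f k‖ ^ 2

/-- Anisotropic Sobolev norm `H^{s,s'}` of a scalar function. -/
def HN (s s' : ℝ) (f : ℝ × ℝ → ℝ) : ℝ := Real.sqrt (HSq s s' f)

/-- Anisotropic Sobolev norm `H^{s,s'}` of a vector field. -/
def HNV (s s' : ℝ) (u : ℝ × ℝ → ℝ × ℝ) : ℝ :=
  Real.sqrt (HSq s s' (comp1 u) + HSq s s' (comp2 u))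

/-- Mixed norm `L^∞_h(L²_v)`. -/
def LinfhL2v (f : ℝ × ℝ → ℝ) : ℝ :=
  essSup (fun x1 : ℝ => Real.sqrt (∫ x2 in I2pi, f (x1, x2) ^ 2)) (volume.restrict I2pi)

/-- Mixed norm `L²_h(L^∞_v)`. -/
def L2hLinfv (f : ℝ × ℝ → ℝ) : ℝ :=
  Real.sqrt (∫ x1 in I2pi, (essSup (fun x2 : ℝ => |f (x1, x2)|) (volume.restrict I2pi)) ^ 2)

/-- Mixed norm `L²_v(L^{4/3}_h)`. -/
def L2vL43h {E : Type*} [NormedAddCommGroup E] (f : ℝ × ℝ → E) : ℝ :=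
  Real.sqrt (∫ x2 in I2pi, (∫ x1 in I2pi, ‖f (x1, x2)‖ ^ ((4 : ℝ)/3)) ^ ((3 : ℝ)/2))

/-- Mixed norm `L^∞_v(L²_h)`. -/
def LinfvL2h {E : Type*} [NormedAddCommGroup E] (f : ℝ × ℝ → E) : ℝ :=
  essSup (fun x2 : ℝ => Real.sqrt (∫ x1 in I2pi, ‖f (x1, x2)‖ ^ 2)) (volume.restrict I2pi)

/-- Mixed norm `L²_v(L⁴_h)`. -/
def L2vL4h {E : Type*} [NormedAddCommGroup E] (f : ℝ × ℝ → E) : ℝ :=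
  Real.sqrt (∫ x2 in I2pi, Real.sqrt (∫ x1 in I2pi, ‖f (x1, x2)‖ ^ 4))

/-- One-dimensional Fourier coefficient on the circle of circumference `2π`. -/
def fc1 (g : ℝ → ℂ) (n : ℤ) : ℂ :=
  (1 / (2 * π) : ℂ) * ∫ x in I2pi, g x * Complex.exp (-(Complex.I) * ((n : ℂ) * (x : ℂ)))

/-- Square of the 1-d Sobolev norm `H^s(𝕋)`. -/
def H1Sq (s : ℝ) (g : ℝ → ℂ) : ℝ := ∑' n : ℤ, (1 + (n : ℝ) ^ 2) ^ s * ‖fc1 g n‖ ^ 2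

/-- Mixed norm `L²_v(H^s_h)`. -/
def L2vHsh (s : ℝ) (f : ℝ × ℝ → ℂ) : ℝ :=
  Real.sqrt (∫ x2 in I2pi, H1Sq s (fun x1 => f (x1, x2)))

/-- A dyadic partition of unity `(χ, θ)` on `ℝ`. -/
structure IsDyadicPartition (χ θ : ℝ → ℝ) : Prop where
  smooth_chi : ContDiff ℝ (⊤ : ℕ∞) χ
  smooth_theta : ContDiff ℝ (⊤ : ℕ∞) θ
  nonneg_chi : ∀ z, 0 ≤ χ z
  nonneg_theta : ∀ z, 0 ≤ θ z
  even_chi : ∀ z, χ (-z) = χ z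
  even_theta : ∀ z, θ (-z) = θ z
  chi_support : ∃ R > 0, ∀ z, R ≤ |z| → χ z = 0
  theta_support : ∃ r R : ℝ, 0 < r ∧ r < R ∧ ∀ z, (|z| < r ∨ R < |z|) → θ z = 0
  partition : ∀ z : ℝ, χ z + ∑' j : ℕ, θ ((2 : ℝ) ^ (-(j : ℤ)) * z) = 1
  chi_theta_disj : ∀ j : ℕ, 1 ≤ j → ∀ z, χ z * θ ((2 : ℝ) ^ (-(j : ℤ)) * z) = 0
  theta_theta_disj : ∀ i j : ℕ, 1 < |(i : ℤ) - (j : ℤ)| → ∀ z,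
    θ ((2 : ℝ) ^ (-(i : ℤ)) * z) * θ ((2 : ℝ) ^ (-(j : ℤ)) * z) = 0

/-- The Fourier multiplier symbol of the vertical Littlewood–Paley block `Δ^v_j`. -/
def blockSymb (χ θ : ℝ → ℝ) (j : ℤ) (z : ℝ) : ℝ :=
  if j = -1 then χ |z| else if 0 ≤ j then θ ((2 : ℝ) ^ (-j) * |z|) else 0

/-- The Fourier multiplier symbol of the vertical low-frequency cut-off `S^v_j`. -/
def lowSymb (χ θ : ℝ → ℝ) (j : ℤ) (z : ℝ) : ℝ :=
  ∑ j' ∈ Finset.Icc (-1 : ℤ) (j - 2), blockSymb χ θ j' z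

/-- The character `e^{ik·x}`. -/
def eK (k : ℤ × ℤ) (x : ℝ × ℝ) : ℂ :=
  Complex.exp (Complex.I * ((k.1 : ℂ) * (x.1 : ℂ) + (k.2 : ℂ) * (x.2 : ℂ)))

/-- Vertical Littlewood–Paley block `Δ^v_j` of a complex-valued function. -/
def LPC (χ θ : ℝ → ℝ) (j : ℤ) (f : ℝ × ℝ → ℂ) : ℝ × ℝ → ℂ :=
  fun x => ∑' k : ℤ × ℤ, (blockSymb χ θ j k.2 : ℂ) * fcC f k * eK k x

/-- Vertical Littlewood–Paley block `Δ^v_j` of a real-valued function. -/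
def LP (χ θ : ℝ → ℝ) (j : ℤ) (f : ℝ × ℝ → ℝ) : ℝ × ℝ → ℂ :=
  LPC χ θ j fun x => (f x : ℂ)

/-- Vertical low-frequency cut-off `S^v_j` of a complex-valued function. -/
def SvC (χ θ : ℝ → ℝ) (j : ℤ) (f : ℝ × ℝ → ℂ) : ℝ × ℝ → ℂ :=
  fun x => ∑' k : ℤ × ℤ, (lowSymb χ θ j k.2 : ℂ) * fcC f k * eK k x

/-- Vertical low-frequency cut-off `S^v_j` of a real-valued function. -/
def Sv (χ θ : ℝ → ℝ) (j : ℤ) (f : ℝ × ℝ → ℝ) : ℝ × ℝ → ℂ :=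
  SvC χ θ j fun x => (f x : ℂ)

/-- Componentwise Littlewood–Paley block of a vector field. -/
def LPV (χ θ : ℝ → ℝ) (j : ℤ) (u : ℝ × ℝ → ℝ × ℝ) : ℝ × ℝ → ℂ × ℂ :=
  fun x => (LP χ θ j (comp1 u) x, LP χ θ j (comp2 u) x)

/-- Componentwise low-frequency cut-off of a vector field. -/
def SvV (χ θ : ℝ → ℝ) (j : ℤ) (u : ℝ × ℝ → ℝ × ℝ) : ℝ × ℝ → ℂ × ℂ :=
  fun x => (Sv χ θ j (comp1 u) x, Sv χ θ j (comp2 u) x)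

/-- L² inner product of complex-valued functions on the torus. -/
def ipC (f g : ℝ × ℝ → ℂ) : ℂ := ∫ x in Q2, f x * (starRingEnd ℂ) (g x)

/-- L² inner product of complex vector fields on the torus (summed over components). -/
def ipCV (f g : ℝ × ℝ → ℂ × ℂ) : ℂ :=
  ∫ x in Q2, ((f x).1 * (starRingEnd ℂ) ((g x).1) + (f x).2 * (starRingEnd ℂ) ((g x).2))

/-- The vertical paraproduct `T^v_a g = Σ_j S^v_{j-1}a · Δ^v_j g`. -/
def Tv (χ θ : ℝ → ℝ) (a g : ℝ × ℝ → ℝ) : ℝ × ℝ → ℂ :=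
  fun x => ∑' j : ℤ, Sv χ θ (j - 1) a x * LP χ θ j g x

/-- The vertical remainder `R^v(a,g) = Σ_{|j-j'|≤1} Δ^v_j a · Δ^v_{j'} g`. -/
def Rv (χ θ : ℝ → ℝ) (a g : ℝ × ℝ → ℝ) : ℝ × ℝ → ℂ :=
  fun x => ∑' p : ℤ × ℤ, if |p.1 - p.2| ≤ 1 then LP χ θ p.1 a x * LP χ θ p.2 g x else 0

/-! ### Exponentials and integrability on the torus -/

lemma eK_zero (x : ℝ × ℝ) : eK 0 x = 1 := by simp [eK]

lemma eK_add (k l : ℤ × ℤ) (x : ℝ × ℝ) : eK (k + l) x = eK k x * eK l x := by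
  simp only [eK, Prod.fst_add, Prod.snd_add, ← Complex.exp_add]
  push_cast
  ring_nf

lemma norm_eK (k : ℤ × ℤ) (x : ℝ × ℝ) : ‖eK k x‖ = 1 := by
  have h : Complex.I * ((k.1 : ℂ) * (x.1 : ℂ) + (k.2 : ℂ) * (x.2 : ℂ))
      = ((k.1 * x.1 + k.2 * x.2 : ℝ) : ℂ) * Complex.I := by push_cast; ring
  rw [eK, h, Complex.norm_exp_ofReal_mul_I]

lemma conj_eK (k : ℤ × ℤ) (x : ℝ × ℝ) : (starRingEnd ℂ) (eK k x) = eK (-k) x := by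
  simp only [eK, ← Complex.exp_conj, map_mul, map_add, Complex.conj_I, Complex.conj_ofReal,
    Prod.fst_neg, Prod.snd_neg, map_intCast]
  push_cast
  ring_nf

lemma continuous_eK (k : ℤ × ℤ) : Continuous (eK k) := by
  unfold eK
  fun_prop

lemma fcC_eq (f : ℝ × ℝ → ℂ) (k : ℤ × ℤ) :
    fcC f k = (1 / (2 * π) ^ 2 : ℂ) * ∫ x in Q2, f x * eK (-k) x := by
  unfold fcC eK
  congr 2
  ext x
  congr 2
  push_cast [Prod.fst_neg, Prod.snd_neg]
  ring

lemma two_pi_sq_ne : (((2 * π) ^ 2 : ℝ) : ℂ) ≠ 0 := by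
  have : (2 * π) ^ 2 ≠ 0 := by positivity
  exact_mod_cast this

lemma integral_mul_eK (f : ℝ × ℝ → ℂ) (k : ℤ × ℤ) :
    ∫ x in Q2, f x * eK k x = ((2 * π) ^ 2 : ℂ) * fcC f (-k) := by
  have h := two_pi_sq_ne
  push_cast at h
  rw [fcC_eq, neg_neg, ← mul_assoc, mul_one_div_cancel h, one_mul]

lemma Q2_subset_Icc : Q2 ⊆ Icc ((0, 0) : ℝ × ℝ) (2 * π, 2 * π) := by
  rw [← Icc_prod_Icc]
  exact prod_mono Ioc_subset_Icc_self Ioc_subset_Icc_self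

lemma Q2_ae_eq_Icc : Q2 =ᵐ[volume] Icc ((0, 0) : ℝ × ℝ) (2 * π, 2 * π) := by
  rw [← Icc_prod_Icc]
  exact Measure.set_prod_ae_eq Ioc_ae_eq_Icc Ioc_ae_eq_Icc

lemma integrableOn_Q2 {f : ℝ × ℝ → ℂ} (hf : Continuous f) : IntegrableOn f Q2 :=
  (hf.continuousOn.integrableOn_compact isCompact_Icc).mono_set Q2_subset_Icc

lemma volume_Q2 : (volume : Measure (ℝ × ℝ)).real Q2 = (2 * π) ^ 2 := by
  rw [Q2, Measure.volume_eq_prod, measureReal_prod_prod, I2pi, Real.volume_real_Ioc]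
  rw [sub_zero, max_eq_left (by positivity)]
  ring

/-! ### Smooth periodic functions -/

/-- Smooth functions on the torus. -/
structure SmoothPer (f : ℝ × ℝ → ℝ) : Prop where
  smooth : ContDiff ℝ (⊤ : ℕ∞) f
  per : Per f

namespace SmoothPer

variable {f g : ℝ × ℝ → ℝ}

lemma add (hf : SmoothPer f) (hg : SmoothPer g) : SmoothPer fun x => f x + g x :=
  ⟨hf.smooth.add hg.smooth, fun x => by simp only [hf.per.1, hg.per.1], fun x => by
    simp only [hf.per.2, hg.per.2]⟩

lemma sub (hf : SmoothPer f) (hg : SmoothPer g) : SmoothPer fun x => f x - g x :=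
  ⟨hf.smooth.sub hg.smooth, fun x => by simp only [hf.per.1, hg.per.1], fun x => by
    simp only [hf.per.2, hg.per.2]⟩

lemma mul (hf : SmoothPer f) (hg : SmoothPer g) : SmoothPer fun x => f x * g x :=
  ⟨hf.smooth.mul hg.smooth, fun x => by simp only [hf.per.1, hg.per.1], fun x => by
    simp only [hf.per.2, hg.per.2]⟩

lemma fderiv_apply (hf : SmoothPer f) (v : ℝ × ℝ) : SmoothPer fun x => fderiv ℝ f x v := by
  refine ⟨(hf.smooth.fderiv_right (m := (⊤ : ℕ∞)) (by simp)).clm_apply contDiff_const,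
    fun x => ?_, fun x => ?_⟩
  · have h : (fun y => f (y + (2 * π, 0))) = f := by
      ext y
      rw [← hf.per.1 y]
      congr 1
      ext <;> simp
    have h' := fderiv_comp_add_right (𝕜 := ℝ) (f := f) (x := x) (2 * π, 0)
    rw [h] at h'
    beta_reduce
    rw [h']
    congr 3
    all_goals simp
  · have h : (fun y => f (y + (0, 2 * π))) = f := by
      ext y
      rw [← hf.per.2 y]
      congr 1
      ext <;> simp
    have h' := fderiv_comp_add_right (𝕜 := ℝ) (f := f) (x := x) (0, 2 * π)
    rw [h] at h'
    beta_reduce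
    rw [h']
    congr 3
    all_goals simp

lemma pd1 (hf : SmoothPer f) : SmoothPer (pd1 f) := hf.fderiv_apply _

lemma pd2 (hf : SmoothPer f) : SmoothPer (pd2 f) := hf.fderiv_apply _

lemma continuous_ofReal (hf : SmoothPer f) : Continuous fun x => (f x : ℂ) :=
  Complex.continuous_ofReal.comp hf.smooth.continuous

lemma hasFDerivAt_ofReal (hf : SmoothPer f) (x : ℝ × ℝ) :
    HasFDerivAt (fun x => (f x : ℂ)) (Complex.ofRealCLM.comp (fderiv ℝ f x)) x :=
  Complex.ofRealCLM.hasFDerivAt.comp x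
    (hf.smooth.differentiable (by simp)).differentiableAt.hasFDerivAt

end SmoothPer

/-- The differential of the character `e^{ik·x}`. -/
def eKDeriv (k : ℤ × ℤ) (x : ℝ × ℝ) : ℝ × ℝ →L[ℝ] ℂ :=
  eK k x • Complex.I • ((k.1 : ℂ) • Complex.ofRealCLM.comp (ContinuousLinearMap.fst ℝ ℝ ℝ)
    + (k.2 : ℂ) • Complex.ofRealCLM.comp (ContinuousLinearMap.snd ℝ ℝ ℝ))

lemma hasFDerivAt_eK (k : ℤ × ℤ) (x : ℝ × ℝ) : HasFDerivAt (eK k) (eKDeriv k x) x := by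
  have h : HasFDerivAt (fun x : ℝ × ℝ =>
      Complex.I * ((k.1 : ℂ) * (x.1 : ℂ) + (k.2 : ℂ) * (x.2 : ℂ)))
      (Complex.I • ((k.1 : ℂ) • Complex.ofRealCLM.comp (ContinuousLinearMap.fst ℝ ℝ ℝ)
        + (k.2 : ℂ) • Complex.ofRealCLM.comp (ContinuousLinearMap.snd ℝ ℝ ℝ))) x :=
    (Complex.I • ((k.1 : ℂ) • Complex.ofRealCLM.comp (ContinuousLinearMap.fst ℝ ℝ ℝ)
        + (k.2 : ℂ) • Complex.ofRealCLM.comp (ContinuousLinearMap.snd ℝ ℝ ℝ))).hasFDerivAt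
  exact h.cexp

lemma eK_per (k : ℤ × ℤ) : (∀ x : ℝ × ℝ, eK k (x.1 + 2 * π, x.2) = eK k x) ∧
    (∀ x : ℝ × ℝ, eK k (x.1, x.2 + 2 * π) = eK k x) := by
  constructor <;> intro x
  · rw [eK, eK, Complex.exp_eq_exp_iff_exists_int]
    exact ⟨k.1, by push_cast; ring⟩
  · rw [eK, eK, Complex.exp_eq_exp_iff_exists_int]
    exact ⟨k.2, by push_cast; ring⟩

lemma integral_deriv_eq_zero {F : ℝ × ℝ → ℂ} {F' : ℝ × ℝ → ℝ × ℝ →L[ℝ] ℂ}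
    (hF : ∀ x, HasFDerivAt F (F' x) x)
    (h1 : ∀ x : ℝ × ℝ, F (x.1 + 2 * π, x.2) = F x) (h2 : ∀ x : ℝ × ℝ, F (x.1, x.2 + 2 * π) = F x)
    (hc : Continuous F') :
    (∫ x in Q2, F' x (1, 0)) = 0 ∧ (∫ x in Q2, F' x (0, 1)) = 0 := by
  have hle : ((0, 0) : ℝ × ℝ) ≤ (2 * π, 2 * π) :=
    Prod.mk_le_mk.2 ⟨by positivity, by positivity⟩
  have hcF : Continuous F := continuous_iff_continuousAt.2 fun x => (hF x).continuousAt
  have hz : ∀ x, HasFDerivAt (fun _ : ℝ × ℝ => (0 : ℂ)) (0 : ℝ × ℝ →L[ℝ] ℂ) x :=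
    fun x => hasFDerivAt_const _ _
  constructor
  · rw [setIntegral_congr_set Q2_ae_eq_Icc]
    have := integral_divergence_prod_Icc_of_hasFDerivAt_of_le F (fun _ => 0) F' (fun _ => 0)
      (0, 0) (2 * π, 2 * π) hle hcF.continuousOn continuousOn_const (fun x _ => hF x)
      (fun x _ => hz x) (by
        refine Continuous.integrableOn_Icc ?_
        simpa using hc.clm_apply continuous_const)
    simp only [_root_.zero_apply, add_zero] at this
    rw [this]
    have h : ∀ y, F (2 * π, y) = F (0, y) := fun y => by simpa using h1 (0, y)
    simp [h]
  · rw [setIntegral_congr_set Q2_ae_eq_Icc]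
    have := integral_divergence_prod_Icc_of_hasFDerivAt_of_le (fun _ => 0) F (fun _ => 0) F'
      (0, 0) (2 * π, 2 * π) hle continuousOn_const hcF.continuousOn (fun x _ => hz x)
      (fun x _ => hF x) (by
        refine Continuous.integrableOn_Icc ?_
        simpa using hc.clm_apply continuous_const)
    simp only [_root_.zero_apply, zero_add] at this
    rw [this]
    have h : ∀ y, F (y, 2 * π) = F (y, 0) := fun y => by simpa using h2 (y, 0)
    simp [h]

lemma fc_pd {f : ℝ × ℝ → ℝ} (hf : SmoothPer f) (k : ℤ × ℤ) :
    fc (pd1 f) k = Complex.I * k.1 * fc f k ∧ fc (pd2 f) k = Complex.I * k.2 * fc f k := by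
  have hF : ∀ x, HasFDerivAt (fun x => (f x : ℂ) * eK (-k) x)
      ((f x : ℂ) • eKDeriv (-k) x + eK (-k) x • Complex.ofRealCLM.comp (fderiv ℝ f x)) x :=
    fun x => (hf.hasFDerivAt_ofReal x).mul (hasFDerivAt_eK _ _)
  have hce : Continuous (eKDeriv (-k)) := by
    unfold eKDeriv
    exact (continuous_eK _).smul continuous_const
  have hcf : Continuous fun x => Complex.ofRealCLM.comp (fderiv ℝ f x) :=
    continuous_const.clm_comp (hf.smooth.continuous_fderiv (by simp))
  have hc := (hf.continuous_ofReal.smul hce).add ((continuous_eK (-k)).smul hcf)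
  obtain ⟨h1, h2⟩ := integral_deriv_eq_zero hF
    (fun x => by rw [hf.per.1, (eK_per _).1]) (fun x => by rw [hf.per.2, (eK_per _).2]) hc
  have hI0 : IntegrableOn (fun x => (f x : ℂ) * eK (-k) x) Q2 :=
    integrableOn_Q2 (hf.continuous_ofReal.mul (continuous_eK _))
  constructor
  · have hI1 : IntegrableOn (fun x => (pd1 f x : ℂ) * eK (-k) x) Q2 :=
      integrableOn_Q2 (hf.pd1.continuous_ofReal.mul (continuous_eK _))
    have e : ∀ x, ((f x : ℂ) • eKDeriv (-k) x
        + eK (-k) x • Complex.ofRealCLM.comp (fderiv ℝ f x)) (1, 0)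
        = (pd1 f x : ℂ) * eK (-k) x - Complex.I * k.1 * ((f x : ℂ) * eK (-k) x) := fun x => by
      simp [eKDeriv, pd1]
      ring
    simp_rw [e] at h1
    rw [integral_sub hI1 (hI0.const_mul _), integral_const_mul, sub_eq_zero] at h1
    rw [fc, fcC_eq, h1, fc, fcC_eq]
    ring
  · have hI1 : IntegrableOn (fun x => (pd2 f x : ℂ) * eK (-k) x) Q2 :=
      integrableOn_Q2 (hf.pd2.continuous_ofReal.mul (continuous_eK _))
    have e : ∀ x, ((f x : ℂ) • eKDeriv (-k) x
        + eK (-k) x • Complex.ofRealCLM.comp (fderiv ℝ f x)) (0, 1)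
        = (pd2 f x : ℂ) * eK (-k) x - Complex.I * k.2 * ((f x : ℂ) * eK (-k) x) := fun x => by
      simp [eKDeriv, pd2]
      ring
    simp_rw [e] at h2
    rw [integral_sub hI1 (hI0.const_mul _), integral_const_mul, sub_eq_zero] at h2
    rw [fc, fcC_eq, h2, fc, fcC_eq]
    ring

lemma fc_neg (f : ℝ × ℝ → ℝ) (k : ℤ × ℤ) : fc f (-k) = (starRingEnd ℂ) (fc f k) := by
  rw [fc, fc, fcC_eq, fcC_eq, map_mul, ← integral_conj]
  have h2 : (starRingEnd ℂ) (2 : ℂ) = 2 := Complex.conj_ofNat 2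
  simp [conj_eK, h2]

lemma fcC_add {f g : ℝ × ℝ → ℂ} (hf : Continuous f) (hg : Continuous g) (k : ℤ × ℤ) :
    fcC (fun x => f x + g x) k = fcC f k + fcC g k := by
  simp only [fcC_eq, add_mul]
  rw [← mul_add, ← integral_add
    (integrableOn_Q2 (f := fun x => f x * eK (-k) x) (hf.mul (continuous_eK _)))
    (integrableOn_Q2 (f := fun x => g x * eK (-k) x) (hg.mul (continuous_eK _)))]

lemma fc_add {f g : ℝ × ℝ → ℝ} (hf : SmoothPer f) (hg : SmoothPer g) (k : ℤ × ℤ) :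
    fc (fun x => f x + g x) k = fc f k + fc g k := by
  rw [fc, fc, fc, ← fcC_add hf.continuous_ofReal hg.continuous_ofReal]
  simp

lemma fc_sub {f g : ℝ × ℝ → ℝ} (hf : SmoothPer f) (hg : SmoothPer g) (k : ℤ × ℤ) :
    fc (fun x => f x - g x) k = fc f k - fc g k := by
  have h := fc_add (hf.sub hg) hg k
  simp only [sub_add_cancel] at h
  rw [h, add_sub_cancel_right]

/-! ### Decay of Fourier coefficients -/

lemma norm_fc_le (f : ℝ × ℝ → ℝ) : ∃ C, ∀ k, ‖fc f k‖ ≤ C := by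
  refine ⟨‖(1 / (2 * π) ^ 2 : ℂ)‖ * ∫ x in Q2, ‖(f x : ℂ)‖, fun k => ?_⟩
  rw [fc, fcC_eq, norm_mul]
  gcongr
  refine (norm_integral_le_integral_norm _).trans (le_of_eq ?_)
  simp [norm_eK]

lemma fc_decay (m n : ℕ) : ∀ {f : ℝ × ℝ → ℝ}, SmoothPer f →
    ∃ C, ∀ k : ℤ × ℤ, (1 + (k.1 : ℝ) ^ 2) ^ m * (1 + (k.2 : ℝ) ^ 2) ^ n * ‖fc f k‖ ≤ C := by
  induction m with
  | zero =>
    induction n with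
    | zero =>
      intro f hf
      simpa using norm_fc_le f
    | succ n ih =>
      intro f hf
      obtain ⟨C, hC⟩ := ih (hf.sub hf.pd2.pd2)
      refine ⟨C, fun k => (le_of_eq ?_).trans (hC k)⟩
      have h : fc (fun x => f x - pd2 (pd2 f) x) k = ((1 + (k.2 : ℝ) ^ 2 : ℝ) : ℂ) * fc f k := by
        rw [fc_sub hf hf.pd2.pd2, (fc_pd hf.pd2 k).2, (fc_pd hf k).2]
        push_cast
        linear_combination (-(k.2 : ℂ) ^ 2 * fc f k) * Complex.I_sq
      rw [h, norm_mul, Complex.norm_real, Real.norm_of_nonneg (by positivity)]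
      ring
  | succ m ih =>
    intro f hf
    obtain ⟨C, hC⟩ := ih (hf.sub hf.pd1.pd1)
    refine ⟨C, fun k => (le_of_eq ?_).trans (hC k)⟩
    have h : fc (fun x => f x - pd1 (pd1 f) x) k = ((1 + (k.1 : ℝ) ^ 2 : ℝ) : ℂ) * fc f k := by
      rw [fc_sub hf hf.pd1.pd1, (fc_pd hf.pd1 k).1, (fc_pd hf k).1]
      push_cast
      linear_combination (-(k.1 : ℂ) ^ 2 * fc f k) * Complex.I_sq
    rw [h, norm_mul, Complex.norm_real, Real.norm_of_nonneg (by positivity)]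
    ring

lemma summable_inv_one_add_sq : Summable fun n : ℤ => (1 + (n : ℝ) ^ 2)⁻¹ := by
  have h := ((Real.summable_one_div_int_add_rpow (1 / 2) 2).2 (by norm_num)).mul_left 2
  refine Summable.of_nonneg_of_le (fun n => by positivity) (fun n => ?_) h
  have h0 : (n : ℝ) + 1 / 2 ≠ 0 := by
    intro h
    have h1 : (2 * n + 1 : ℝ) = 0 := by linarith
    have h2 : 2 * n + 1 = 0 := by exact_mod_cast h1
    omega
  have h1 : 0 < ((n : ℝ) + 1 / 2) ^ 2 := by positivity
  rw [Real.rpow_two, sq_abs, mul_one_div, inv_eq_one_div, div_le_div_iff₀ (by positivity) h1]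
  nlinarith [sq_nonneg ((n : ℝ) - 1 / 2)]

lemma summable_inv_weight :
    Summable fun k : ℤ × ℤ => (1 + (k.1 : ℝ) ^ 2)⁻¹ * (1 + (k.2 : ℝ) ^ 2)⁻¹ :=
  summable_inv_one_add_sq.mul_of_nonneg summable_inv_one_add_sq
    (fun n => by positivity) (fun n => by positivity)

lemma summable_weight_fc (m n : ℕ) {f : ℝ × ℝ → ℝ} (hf : SmoothPer f) :
    Summable fun k : ℤ × ℤ => (1 + (k.1 : ℝ) ^ 2) ^ m * (1 + (k.2 : ℝ) ^ 2) ^ n * ‖fc f k‖ := by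
  obtain ⟨C, hC⟩ := fc_decay (m + 1) (n + 1) hf
  refine Summable.of_nonneg_of_le (fun k => by positivity) (fun k => ?_)
    (summable_inv_weight.mul_left C)
  rw [← mul_inv, ← div_eq_mul_inv, le_div_iff₀ (by positivity)]
  refine (le_of_eq ?_).trans (hC k)
  ring

lemma summable_norm_fc {f : ℝ × ℝ → ℝ} (hf : SmoothPer f) : Summable fun k => ‖fc f k‖ := by
  simpa using summable_weight_fc 0 0 hf

lemma summable_weight_fc_sq (m n : ℕ) {f : ℝ × ℝ → ℝ} (hf : SmoothPer f) :
    Summable fun k : ℤ × ℤ =>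
      (1 + (k.1 : ℝ) ^ 2) ^ m * (1 + (k.2 : ℝ) ^ 2) ^ n * ‖fc f k‖ ^ 2 := by
  obtain ⟨C, hC⟩ := norm_fc_le f
  refine Summable.of_nonneg_of_le (fun k => by positivity) (fun k => ?_)
    ((summable_weight_fc m n hf).mul_left C)
  have h := mul_le_mul_of_nonneg_right (hC k)
    (by positivity : 0 ≤ (1 + (k.1 : ℝ) ^ 2) ^ m * (1 + (k.2 : ℝ) ^ 2) ^ n * ‖fc f k‖)
  exact (le_of_eq (by ring)).trans h

/-! ### Fourier series on the torus -/

lemma integral_eK (k : ℤ × ℤ) : ∫ x in Q2, eK k x = if k = 0 then ((2 * π) ^ 2 : ℂ) else 0 := by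
  split_ifs with hk
  · subst hk
    simp only [eK_zero, integral_const, measureReal_restrict_apply_univ, volume_Q2]
    simp
  · have hce : Continuous (eKDeriv k) := by
      unfold eKDeriv
      exact (continuous_eK _).smul continuous_const
    obtain ⟨h1, h2⟩ := integral_deriv_eq_zero (hasFDerivAt_eK k) (eK_per k).1 (eK_per k).2 hce
    have e1 : ∀ x, eKDeriv k x (1, 0) = (Complex.I * k.1) * eK k x := fun x => by
      simp [eKDeriv]; ring
    have e2 : ∀ x, eKDeriv k x (0, 1) = (Complex.I * k.2) * eK k x := fun x => by
      simp [eKDeriv]; ring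
    simp_rw [e1, integral_const_mul] at h1
    simp_rw [e2, integral_const_mul] at h2
    by_contra h
    apply hk
    simp only [mul_eq_zero, h, or_false, Complex.I_ne_zero, false_or, Int.cast_eq_zero] at h1 h2
    exact Prod.ext h1 h2

lemma hasSum_integral_series {c : ℤ × ℤ → ℂ} (hc : Summable fun k => ‖c k‖) {h : ℝ × ℝ → ℂ}
    (hh : Continuous h) :
    HasSum (fun k => c k * ∫ x in Q2, eK k x * h x) (∫ x in Q2, (∑' k, c k * eK k x) * h x) := by
  have h1 := hasSum_integral_of_summable_integral_norm (μ := volume.restrict Q2)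
    (F := fun k x => c k * (eK k x * h x))
    (fun k => integrableOn_Q2 (continuous_const.mul ((continuous_eK k).mul hh)))
    (by simpa [norm_eK, integral_const_mul] using hc.mul_right _)
  simp only [integral_const_mul] at h1
  have e : (fun x => (∑' k, c k * eK k x) * h x) = fun x => ∑' k, c k * (eK k x * h x) := by
    ext x
    rw [← tsum_mul_right]
    simp only [mul_assoc]
  rw [e]
  exact h1

lemma continuous_series {c : ℤ × ℤ → ℂ} (hc : Summable fun k => ‖c k‖) :
    Continuous fun x => ∑' k, c k * eK k x :=
  continuous_tsum (fun k => continuous_const.mul (continuous_eK k)) hc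
    fun k x => by simp [norm_eK]

lemma fcC_series {c : ℤ × ℤ → ℂ} (hc : Summable fun k => ‖c k‖) (m : ℤ × ℤ) :
    fcC (fun x => ∑' k, c k * eK k x) m = c m := by
  have h := hasSum_integral_series hc (continuous_eK (-m))
  have e : ∀ k, ∫ x in Q2, eK k x * eK (-m) x = if k = m then ((2 * π) ^ 2 : ℂ) else 0 := by
    intro k
    simp_rw [← eK_add]
    rw [integral_eK]
    simp [add_neg_eq_zero]
  simp_rw [e] at h
  have h2 := h.unique (hasSum_single m fun k hk => by simp [hk])
  have h0 := two_pi_sq_ne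
  push_cast at h0
  rw [fcC_eq, h2, if_pos rfl, mul_comm (c m), ← mul_assoc, one_div_mul_cancel h0, one_mul]

/-- Parseval's identity for absolutely convergent Fourier series. -/
lemma hasSum_parseval {c d : ℤ × ℤ → ℂ} (hc : Summable fun k => ‖c k‖)
    (hd : Summable fun k => ‖d k‖) :
    HasSum (fun k => ((2 * π) ^ 2 : ℂ) * (c k * (starRingEnd ℂ) (d k)))
      (∫ x in Q2, (∑' k, c k * eK k x) * (starRingEnd ℂ) (∑' k, d k * eK k x)) := by
  have h := hasSum_integral_series hc (h := fun x => (starRingEnd ℂ) (∑' k, d k * eK k x))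
    (Complex.continuous_conj.comp (continuous_series hd))
  convert h using 2 with k
  have e : ∫ x in Q2, eK k x * (starRingEnd ℂ) (∑' k, d k * eK k x)
      = (starRingEnd ℂ) (∫ x in Q2, (∑' k, d k * eK k x) * eK (-k) x) := by
    rw [← integral_conj]
    congr 1
    ext x
    rw [map_mul, conj_eK, neg_neg, mul_comm]
  rw [e, integral_mul_eK, neg_neg, fcC_series hd]
  simp only [map_mul, map_pow, Complex.conj_ofReal, Complex.conj_ofNat]
  ring

lemma hasSum_fc1 {g : ℝ → ℂ} (hg : Continuous g) (hp : Function.Periodic g (2 * π))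
    (hs : Summable fun n => ‖fc1 g n‖) (x : ℝ) :
    HasSum (fun n : ℤ => fc1 g n * Complex.exp (Complex.I * (n * x))) (g x) := by
  have : Fact (0 < 2 * π) := ⟨by positivity⟩
  let G : C(AddCircle (2 * π), ℂ) := ⟨hp.lift, continuous_coinduced_dom.mpr hg⟩
  have hG : ∀ y : ℝ, G (y : AddCircle (2 * π)) = g y := fun y => hp.lift_coe y
  have hcoef : ∀ n, fourierCoeff G n = fc1 g n := by
    intro n
    rw [fourierCoeff_eq_intervalIntegral _ _ 0, fc1, zero_add,
      intervalIntegral.integral_of_le (by positivity), I2pi]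
    simp only [hG, fourier_coe_apply, smul_eq_mul, Complex.real_smul]
    push_cast
    congr 1
    apply setIntegral_congr_fun measurableSet_Ioc
    intro y _
    have : (2 * π : ℂ) ≠ 0 := by exact_mod_cast (by positivity : (2 * π : ℝ) ≠ 0)
    beta_reduce
    rw [mul_comm]
    congr 2
    field_simp
  have h := has_pointwise_sum_fourier_series_of_summable (f := G)
    (by simp_rw [funext hcoef]; exact hs.of_norm) (x : AddCircle (2 * π))
  rw [hG] at h
  convert h using 2 with n
  rw [hcoef, fourier_coe_apply, smul_eq_mul]
  have : (2 * π : ℂ) ≠ 0 := by exact_mod_cast (by positivity : (2 * π : ℝ) ≠ 0)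
  congr 2
  push_cast
  field_simp

/-- Pointwise Fourier inversion on the torus. -/
lemma hasSum_fcC {f : ℝ × ℝ → ℂ} (hf : Continuous f)
    (h1 : ∀ x : ℝ × ℝ, f (x.1 + 2 * π, x.2) = f x) (h2 : ∀ x : ℝ × ℝ, f (x.1, x.2 + 2 * π) = f x)
    (hs : Summable fun k => ‖fcC f k‖) (x : ℝ × ℝ) :
    HasSum (fun k => fcC f k * eK k x) (f x) := by
  have hcont : ∀ n : ℤ, Continuous fun y => fc1 (fun x1 => f (x1, y)) n := by
    intro n
    unfold fc1 I2pi
    simp_rw [← intervalIntegral.integral_of_le (show (0 : ℝ) ≤ 2 * π by positivity)]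
    refine continuous_const.mul ?_
    refine intervalIntegral.continuous_parametric_intervalIntegral_of_continuous' ?_ _ _
    fun_prop
  have hcoef : ∀ n m : ℤ, fc1 (fun y => fc1 (fun x1 => f (x1, y)) n) m = fcC f (n, m) := by
    intro n m
    have hI : IntegrableOn (fun z : ℝ × ℝ => f z * eK (-(n, m)) z) (I2pi ×ˢ I2pi)
      (volume.prod volume) := integrableOn_Q2 (hf.mul (continuous_eK _))
    rw [fcC_eq, Q2, Measure.volume_eq_prod, setIntegral_prod _ hI]
    rw [IntegrableOn, ← Measure.prod_restrict] at hI
    rw [integral_integral_swap hI]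
    unfold fc1
    simp_rw [mul_assoc]
    rw [integral_const_mul, ← mul_assoc]
    congr 1
    · ring
    · congr 1
      ext y
      rw [← integral_mul_const]
      congr 1
      ext z
      simp only [eK, mul_assoc, ← Complex.exp_add]
      congr 2
      push_cast [Prod.fst_neg, Prod.snd_neg]
      ring
  have hfib : ∀ n, HasSum (fun m : ℤ => fcC f (n, m) * Complex.exp (Complex.I * (m * x.2)))
      (fc1 (fun x1 => f (x1, x.2)) n) := by
    intro n
    have h := hasSum_fc1 (hcont n) (fun y => by
      unfold fc1
      simp only [fun x1 => h2 (x1, y)]) (by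
        simp_rw [hcoef]
        exact hs.comp_injective (i := fun m => (n, m)) fun a b h => (Prod.mk.inj h).2) x.2
    simpa only [hcoef] using h
  have hnorm : ∀ (n : ℤ) (t : ℝ), ‖Complex.exp (Complex.I * (n * t))‖ = 1 := by
    intro n t
    rw [show Complex.I * (n * t) = ((n * t : ℝ) : ℂ) * Complex.I by push_cast; ring,
      Complex.norm_exp_ofReal_mul_I]
  have hs1 : Summable fun n => ‖fc1 (fun x1 => f (x1, x.2)) n‖ := by
    refine Summable.of_nonneg_of_le (fun _ => norm_nonneg _) (fun n => ?_) hs.prod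
    refine (hfib n).norm_le_of_bounded (hs.prod_factor n).hasSum fun m => ?_
    rw [norm_mul, hnorm, mul_one]
  have hout := hasSum_fc1 (g := fun x1 => f (x1, x.2)) (by fun_prop)
    (fun y => h1 (y, x.2)) hs1 x.1
  have hS : Summable fun k => fcC f k * eK k x :=
    Summable.of_norm (by simpa [norm_eK] using hs)
  have hS2 := hS.hasSum.prod_fiberwise (fun n => by
    have e : ∀ m, fcC f (n, m) * eK (n, m) x
        = fcC f (n, m) * Complex.exp (Complex.I * (m * x.2)) * Complex.exp (Complex.I * (n * x.1)) := by
      intro m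
      rw [eK, mul_assoc, ← Complex.exp_add]
      congr 2
      ring
    simp_rw [e]
    exact (hfib n).mul_right _)
  rw [← hS2.unique hout]
  exact hS.hasSum

lemma hasSum_fc {f : ℝ × ℝ → ℝ} (hf : SmoothPer f) (x : ℝ × ℝ) :
    HasSum (fun k => fc f k * eK k x) (f x : ℂ) :=
  hasSum_fcC hf.continuous_ofReal (fun x => by rw [hf.per.1]) (fun x => by rw [hf.per.2])
    (summable_norm_fc hf) x

/-- Fourier coefficients of a product are given by convolution. -/
lemma hasSum_fc_mul {f g : ℝ × ℝ → ℝ} (hf : SmoothPer f) (hg : SmoothPer g) (k : ℤ × ℤ) :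
    HasSum (fun q => fc f (k - q) * fc g q) (fc (fun x => f x * g x) k) := by
  have h := (hasSum_integral_series (summable_norm_fc hg)
    (h := fun x => (f x : ℂ) * eK (-k) x) (hf.continuous_ofReal.mul (continuous_eK (-k)))).mul_left (1 / (2 * π) ^ 2 : ℂ)
  have e : (1 / (2 * π) ^ 2 : ℂ) * ∫ x in Q2, (∑' q, fc g q * eK q x) * ((f x : ℂ) * eK (-k) x)
      = fc (fun x => f x * g x) k := by
    rw [fc, fcC_eq]
    congr 2
    ext x
    rw [(hasSum_fc hg x).tsum_eq]
    push_cast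
    ring
  rw [e] at h
  have e2 : ∀ q x, eK q x * ((f x : ℂ) * eK (-k) x) = f x * eK (-(k - q)) x := fun q x => by
    rw [neg_sub, sub_eq_add_neg, eK_add]
    ring
  have e3 : ∀ q, (1 / (2 * π) ^ 2 : ℂ) * (fc g q * ∫ x in Q2, eK q x * ((f x : ℂ) * eK (-k) x))
      = fc f (k - q) * fc g q := fun q => by
    simp_rw [e2]
    rw [show fc f (k - q) = _ from fcC_eq _ _]
    ring
  simp_rw [e3] at h
  exact h

/-! ### Symbols of the Littlewood–Paley blocks -/

lemma sum_eight_pow_le (s : Finset ℕ) {R : ℝ} (hR : 0 ≤ R) (h : ∀ j ∈ s, (2 : ℝ) ^ j ≤ R) :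
    ∑ j ∈ s, (8 : ℝ) ^ j ≤ 2 * R ^ 3 := by
  rcases s.eq_empty_or_nonempty with rfl | hs
  · simpa using by positivity
  · set N := s.max' hs
    have h1 : s ⊆ Finset.range (N + 1) := fun j hj =>
      Finset.mem_range.2 (Nat.lt_succ_of_le (s.le_max' j hj))
    have h2 : (8 : ℝ) ^ N ≤ R ^ 3 := by
      have := pow_le_pow_left₀ (by positivity) (h N (s.max'_mem hs)) 3
      rwa [← pow_mul, mul_comm, pow_mul, show (2 : ℝ) ^ 3 = 8 by norm_num] at this
    calc ∑ j ∈ s, (8 : ℝ) ^ j ≤ ∑ j ∈ Finset.range (N + 1), (8 : ℝ) ^ j :=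
          Finset.sum_le_sum_of_subset_of_nonneg h1 fun _ _ _ => by positivity
      _ = (8 ^ (N + 1) - 1) / (8 - 1) := geom_sum_eq (by norm_num) _
      _ ≤ 2 * R ^ 3 := by
          rw [pow_succ, div_le_iff₀ (by norm_num)]
          linarith [pow_nonneg hR 3]

lemma exists_lipschitz_sq {φ : ℝ → ℝ} (hφ : ContDiff ℝ (⊤ : ℕ∞) φ) {R : ℝ}
    (h : ∀ z, R < |z| → φ z = 0) : ∃ L : ℝ, 0 ≤ L ∧ ∀ x y, |φ x ^ 2 - φ y ^ 2| ≤ L * |x - y| := by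
  have hc : HasCompactSupport fun z => φ z ^ 2 :=
    HasCompactSupport.of_support_subset_isCompact (isCompact_Icc (a := -R) (b := R)) fun z hz => by
      by_contra hz'
      apply hz
      have : R < |z| := by
        by_contra! hR
        exact hz' (abs_le.1 hR)
      simp [h z this]
  obtain ⟨L, hL⟩ := (hφ.pow 2).lipschitzWith_of_hasCompactSupport hc (by simp)
  refine ⟨L, L.2, fun x y => ?_⟩
  simpa [Real.dist_eq] using hL.dist_le_mul x y

lemma exists_bound_of_support {φ : ℝ → ℝ} (hφ : Continuous φ) {R : ℝ}
    (h : ∀ z, R < |z| → φ z = 0) : ∃ C : ℝ, ∀ x, |φ x| ≤ C := by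
  have hc : HasCompactSupport φ :=
    HasCompactSupport.of_support_subset_isCompact (isCompact_Icc (a := -R) (b := R)) fun z hz => by
      by_contra hz'
      apply hz
      have : R < |z| := by
        by_contra! hR
        exact hz' (abs_le.1 hR)
      exact h z this
  obtain ⟨C, hC⟩ := hc.exists_bound_of_continuous hφ
  exact ⟨C, hC⟩

section DyadicPartition

variable {χ θ : ℝ → ℝ}

lemma IsDyadicPartition.exists_bound_blockSymb (hp : IsDyadicPartition χ θ) :
    ∃ C : ℝ, ∀ j x, |blockSymb χ θ j x| ≤ C := by
  obtain ⟨R, -, hR⟩ := hp.chi_support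
  obtain ⟨r, R', -, -, hR'⟩ := hp.theta_support
  obtain ⟨C, hC⟩ := exists_bound_of_support hp.smooth_chi.continuous fun z hz => hR z hz.le
  obtain ⟨C', hC'⟩ := exists_bound_of_support hp.smooth_theta.continuous
    fun z hz => hR' z (Or.inr hz)
  refine ⟨max C C', fun j x => ?_⟩
  unfold blockSymb
  split_ifs
  · exact (hC _).trans (le_max_left _ _)
  · exact (hC' _).trans (le_max_right _ _)
  · rw [abs_zero]
    exact (abs_nonneg _).trans ((hC 0).trans (le_max_left _ _))

lemma blockSymb_neg (j : ℤ) (z : ℝ) : blockSymb χ θ j (-z) = blockSymb χ θ j z := by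
  simp [blockSymb]

/-- Weighted Lipschitz bound for the squared symbols, summed over all dyadic scales. -/
lemma IsDyadicPartition.exists_sum_blockSymb_sq_sub_le (hp : IsDyadicPartition χ θ) :
    ∃ C : ℝ, 0 ≤ C ∧ ∀ (s : Finset {j : ℤ // -1 ≤ j}) (x y M : ℝ), 1 ≤ M → |x| ≤ M → |y| ≤ M →
      ∑ j ∈ s, (2 : ℝ) ^ (4 * (j.1 : ℝ)) *
        |blockSymb χ θ j.1 x ^ 2 - blockSymb χ θ j.1 y ^ 2| ≤ C * (|x - y| * M ^ 3) := by
  obtain ⟨R, -, hR⟩ := hp.chi_support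
  obtain ⟨r, R', hr, -, hR'⟩ := hp.theta_support
  obtain ⟨L, hL0, hL⟩ := exists_lipschitz_sq hp.smooth_chi fun z hz => hR z hz.le
  obtain ⟨L', hL0', hL'⟩ := exists_lipschitz_sq hp.smooth_theta fun z hz => hR' z (Or.inr hz)
  refine ⟨(L + L') * (2 * (1 + 2 / r) ^ 3), by positivity, fun s x y M hM hx hy => ?_⟩
  set B : ℝ := (1 + 2 / r) * M
  have hB : 0 ≤ B := by positivity
  let e : {j : ℤ // -1 ≤ j} → ℕ := fun j => (j.1 + 1).toNat
  have he : Function.Injective e := by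
    intro i j hij
    have hi := i.2
    have hj := j.2
    simp only [e] at hij
    exact Subtype.ext (by omega)
  have hterm : ∀ j : {j : ℤ // -1 ≤ j}, (2 : ℝ) ^ (4 * (j.1 : ℝ)) *
      |blockSymb χ θ j.1 x ^ 2 - blockSymb χ θ j.1 y ^ 2|
      ≤ if (2 : ℝ) ^ e j ≤ B then (L + L') * |x - y| * 8 ^ e j else 0 := by
    rintro ⟨j, hj⟩
    have hxy := abs_abs_sub_abs_le_abs_sub x y
    rcases hj.eq_or_lt with rfl | hj'
    · have h0 : e ⟨-1, hj⟩ = 0 := by simp [e]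
      have h1 : (2 : ℝ) ^ 0 ≤ B := by
        have : 0 ≤ 2 / r * M := by positivity
        simp only [B, pow_zero]
        linarith
      rw [h0, if_pos h1]
      simp only [blockSymb, if_true, pow_zero, mul_one]
      have h2 : (2 : ℝ) ^ (4 * ((-1 : ℤ) : ℝ)) ≤ 1 :=
        Real.rpow_le_one_of_one_le_of_nonpos (by norm_num) (by norm_num)
      calc _ ≤ 1 * (L * |x - y|) := by
            gcongr
            exact (hL _ _).trans (by gcongr)
        _ ≤ _ := by nlinarith [mul_nonneg hL0' (abs_nonneg (x - y))]
    · obtain ⟨n, rfl⟩ := Int.eq_ofNat_of_zero_le (show 0 ≤ j by omega)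
      have h0 : e ⟨(n : ℤ), hj⟩ = n + 1 := by simp only [e]; omega
      have h1 : ¬ ((n : ℤ) = -1) := by omega
      have h2 : (0 : ℤ) ≤ n := by omega
      simp only [h0, blockSymb, if_neg h1, if_pos h2]
      have h16 : (2 : ℝ) ^ (4 * ((n : ℤ) : ℝ)) = 16 ^ n := by
        rw [Int.cast_natCast, Real.rpow_mul (by norm_num), Real.rpow_natCast]
        norm_num
      rw [h16, zpow_neg, zpow_natCast]
      have h2n : (0 : ℝ) < 2 ^ n := by positivity
      split_ifs with hcond
      · calc (16 : ℝ) ^ n * |θ ((2 ^ n)⁻¹ * |x|) ^ 2 - θ ((2 ^ n)⁻¹ * |y|) ^ 2|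
            ≤ 16 ^ n * (L' * abs ((2 ^ n)⁻¹ * |x| - (2 ^ n)⁻¹ * |y|)) := by
              gcongr
              exact hL' _ _
          _ = L' * abs (|x| - |y|) * 8 ^ n := by
              rw [← mul_sub, abs_mul, abs_of_pos (inv_pos.2 h2n),
                show (16 : ℝ) = 8 * 2 by norm_num, mul_pow]
              field_simp
          _ ≤ (L + L') * |x - y| * 8 ^ (n + 1) := by
              gcongr
              · linarith
              · norm_num
              · omega
      · have hz : ∀ z : ℝ, |z| ≤ M → θ ((2 ^ n)⁻¹ * |z|) = 0 := by
          intro z hz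
          apply hR'
          left
          rw [abs_of_nonneg (by positivity), inv_mul_lt_iff₀ h2n]
          push Not at hcond
          rw [pow_succ] at hcond
          have h3 : 2 / r * M ≤ B := by
            simp only [B]
            linarith
          have h4 : 2 / r * M < 2 ^ n * 2 := h3.trans_lt hcond
          rw [div_mul_eq_mul_div, div_lt_iff₀ hr] at h4
          linarith
        simp [hz x hx, hz y hy]
  calc _ ≤ ∑ j ∈ s, if (2 : ℝ) ^ e j ≤ B then (L + L') * |x - y| * 8 ^ e j else 0 :=
        Finset.sum_le_sum fun j _ => hterm j
    _ = ∑ n ∈ s.image e, if (2 : ℝ) ^ n ≤ B then (L + L') * |x - y| * 8 ^ n else 0 := by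
        rw [Finset.sum_image he.injOn]
    _ = (L + L') * |x - y| * ∑ n ∈ s.image e with (2 : ℝ) ^ n ≤ B, 8 ^ n := by
        rw [← Finset.sum_filter, Finset.mul_sum]
    _ ≤ (L + L') * |x - y| * (2 * B ^ 3) := by
        gcongr
        exact sum_eight_pow_le _ hB fun j hj => (Finset.mem_filter.1 hj).2
    _ = _ := by
        simp only [B]
        ring

/-! ### A trilinear estimate on the lattice -/

/-- The summable weight `(1+k₁²)⁻¹(1+k₂²)⁻¹` on the lattice. -/
def invWeight (k : ℤ × ℤ) : ℝ := (1 + (k.1 : ℝ) ^ 2)⁻¹ * (1 + (k.2 : ℝ) ^ 2)⁻¹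

lemma invWeight_nonneg (k : ℤ × ℤ) : 0 ≤ invWeight k := by
  unfold invWeight
  positivity

lemma summable_mul_comp_injective {ι α β : Type*} {f : α → ℝ} {g : β → ℝ} (hf : Summable f)
    (hg : Summable g) (hf0 : ∀ a, 0 ≤ f a) (hg0 : ∀ b, 0 ≤ g b) {σ : ι → α} {τ : ι → β}
    (h : Function.Injective fun i => (σ i, τ i)) :
    (Summable fun i => f (σ i) * g (τ i)) ∧
      ∑' i, f (σ i) * g (τ i) ≤ (∑' a, f a) * ∑' b, g b := by
  have hs := hf.mul_of_nonneg hg hf0 hg0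
  refine ⟨hs.comp_injective h, ?_⟩
  rw [hf.tsum_mul_tsum hg hs]
  exact tsum_comp_le_tsum_of_inj hs (fun _ => mul_nonneg (hf0 _) (hg0 _)) h

lemma summable_trilinear {ι α β γ κ : Type*} {X : α → ℝ} {Y : β → ℝ} {V : γ → ℝ} {w : κ → ℝ}
    (hX : Summable X) (hY : Summable Y) (hV : Summable V) (hw : Summable w)
    (hX0 : ∀ a, 0 ≤ X a) (hY0 : ∀ a, 0 ≤ Y a) (hV0 : ∀ a, 0 ≤ V a) (hw0 : ∀ a, 0 ≤ w a)
    (σ : ι → α) (τ : ι → β) (υ : ι → γ) (ρ : ι → κ)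
    (h1 : Function.Injective fun i => (σ i, υ i)) (h2 : Function.Injective fun i => (τ i, ρ i))
    {t : ι → ℝ} (ht0 : ∀ i, 0 ≤ t i)
    (ht : ∀ i, t i ^ 2 ≤ X (σ i) * V (υ i) * (Y (τ i) * w (ρ i))) {ε : ℝ} (hε : 0 < ε) :
    Summable t ∧
      ∑' i, t i ≤ ε * ((∑' a, X a) * ∑' a, V a) + ε⁻¹ * ((∑' a, Y a) * ∑' a, w a) := by
  obtain ⟨s1, b1⟩ := summable_mul_comp_injective hX hV hX0 hV0 h1
  obtain ⟨s2, b2⟩ := summable_mul_comp_injective hY hw hY0 hw0 h2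
  have hle : ∀ i, t i ≤ ε * (X (σ i) * V (υ i)) + ε⁻¹ * (Y (τ i) * w (ρ i)) := by
    intro i
    have hA : 0 ≤ X (σ i) * V (υ i) := mul_nonneg (hX0 _) (hV0 _)
    have hB : 0 ≤ Y (τ i) * w (ρ i) := mul_nonneg (hY0 _) (hw0 _)
    refine abs_le_of_sq_le_sq' ((ht i).trans ?_) (by positivity) |>.2
    generalize X (σ i) * V (υ i) = A at *
    generalize Y (τ i) * w (ρ i) = B at *
    have h : A * B = (ε * A) * (ε⁻¹ * B) := by field_simp
    have h3 : 0 ≤ ε * A := by positivity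
    have h4 : 0 ≤ ε⁻¹ * B := by positivity
    nlinarith
  have s3 := (s1.mul_left ε).add (s2.mul_left ε⁻¹)
  have s4 := Summable.of_nonneg_of_le ht0 hle s3
  refine ⟨s4, (s4.tsum_le_tsum hle s3).trans ?_⟩
  rw [(s1.mul_left ε).tsum_add (s2.mul_left ε⁻¹), tsum_mul_left, tsum_mul_left]
  gcongr

end DyadicPartition

/-- The Fourier symbol of the trilinear form `⟨u·∇u, u⟩`, where `a` and `b` are the Fourier
coefficients of the two components of `u`. -/
def trilinearSymb (a b : ℤ × ℤ → ℂ) (i : (ℤ × ℤ) × (ℤ × ℤ)) : ℂ :=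
  Complex.I * (a (i.1 - i.2) * i.2.1 + b (i.1 - i.2) * i.2.2) *
    (a i.2 * (starRingEnd ℂ) (a i.1) + b i.2 * (starRingEnd ℂ) (b i.1))

lemma norm_trilinearSymb_le (a b : ℤ × ℤ → ℂ) (i : (ℤ × ℤ) × (ℤ × ℤ)) :
    ‖trilinearSymb a b i‖ ≤ (‖a (i.1 - i.2)‖ * |(i.2.1 : ℝ)| + ‖b (i.1 - i.2)‖ * |(i.2.2 : ℝ)|) *
      ((‖a i.2‖ + ‖b i.2‖) * (‖a i.1‖ + ‖b i.1‖)) := by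
  rw [trilinearSymb, norm_mul, norm_mul, Complex.norm_I, one_mul]
  gcongr
  · refine (norm_add_le _ _).trans (le_of_eq ?_)
    rw [norm_mul, norm_mul, Complex.norm_intCast, Complex.norm_intCast]
  · refine (norm_add_le _ _).trans ?_
    rw [norm_mul, norm_mul, RCLike.norm_conj, RCLike.norm_conj]
    nlinarith [mul_nonneg (norm_nonneg (a i.2)) (norm_nonneg (b i.1)),
      mul_nonneg (norm_nonneg (b i.2)) (norm_nonneg (a i.1))]

/-- The three factors of a weighted trilinear term are controlled by the largest vertical
frequency, the divergence-free condition trading a vertical derivative for a horizontal one. -/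
lemma anisotropic_pointwise_le {A B p₁ p₂ q₁ q₂ k₂ : ℝ} (hA : 0 ≤ A) (hB : 0 ≤ B)
    (hdiv : B * |p₂| = A * |p₁|) (hk : k₂ = p₂ + q₂) :
    (A * |q₁| + B * |q₂|) * (|p₂| * (max 1 (max |k₂| |q₂|)) ^ 3) ≤
      4 * ((|q₁| + |p₁|) * ((1 + q₂ ^ 2) * (1 + k₂ ^ 2) + (1 + p₂ ^ 2) * (1 + q₂ ^ 2) +
        (1 + p₂ ^ 2) * (1 + k₂ ^ 2)) * (A + B)) := by
  set M := max 1 (max |k₂| |q₂|)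
  have hM1 : 1 ≤ M := le_max_left _ _
  have hMk : |k₂| ≤ M := (le_max_left _ _).trans (le_max_right _ _)
  have hMq : |q₂| ≤ M := (le_max_right _ _).trans (le_max_right _ _)
  have hMp : |p₂| ≤ 2 * M := by
    have : p₂ = k₂ - q₂ := by linarith
    rw [this]
    linarith [abs_sub k₂ q₂]
  have h4 : M ^ 4 ≤ 2 * ((1 + q₂ ^ 2) * (1 + k₂ ^ 2) + (1 + p₂ ^ 2) * (1 + q₂ ^ 2) +
        (1 + p₂ ^ 2) * (1 + k₂ ^ 2)) := by
    have hM : M ^ 2 ≤ 1 + q₂ ^ 2 ∨ M ^ 2 ≤ 1 + k₂ ^ 2 := by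
      have hM' : M = 1 ∨ M = |k₂| ∨ M = |q₂| := by
        rcases max_choice 1 (max |k₂| |q₂|) with h | h
        · exact Or.inl h
        · rcases max_choice |k₂| |q₂| with h' | h'
          · exact Or.inr (Or.inl (h.trans h'))
          · exact Or.inr (Or.inr (h.trans h'))
      rcases hM' with h | h | h
      · left; rw [h]; nlinarith [sq_nonneg q₂]
      · right; rw [h, sq_abs]; linarith
      · left; rw [h, sq_abs]; linarith
    have e : M ^ 4 = M ^ 2 * M ^ 2 := by ring
    have hp2 := sq_nonneg p₂
    have hq2 := sq_nonneg q₂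
    have hk2 := sq_nonneg k₂
    rcases hM with h | h
    · have h2 : 1 + q₂ ^ 2 ≤ 2 * (1 + k₂ ^ 2) + 2 * (1 + p₂ ^ 2) := by
        rw [hk]; nlinarith [sq_nonneg (p₂ + q₂ + p₂)]
      calc M ^ 4 ≤ (1 + q₂ ^ 2) * (1 + q₂ ^ 2) := by rw [e]; gcongr
        _ ≤ (1 + q₂ ^ 2) * (2 * (1 + k₂ ^ 2) + 2 * (1 + p₂ ^ 2)) := by gcongr
        _ ≤ _ := by nlinarith [mul_nonneg hp2 hk2]
    · have h2 : 1 + k₂ ^ 2 ≤ 2 * (1 + q₂ ^ 2) + 2 * (1 + p₂ ^ 2) := by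
        rw [hk]; nlinarith [sq_nonneg (p₂ - q₂)]
      calc M ^ 4 ≤ (1 + k₂ ^ 2) * (1 + k₂ ^ 2) := by rw [e]; gcongr
        _ ≤ (1 + k₂ ^ 2) * (2 * (1 + q₂ ^ 2) + 2 * (1 + p₂ ^ 2)) := by gcongr
        _ ≤ _ := by nlinarith [mul_nonneg hp2 hq2]
  calc (A * |q₁| + B * |q₂|) * (|p₂| * M ^ 3)
      = A * |q₁| * |p₂| * M ^ 3 + (B * |p₂|) * |q₂| * M ^ 3 := by ring
    _ ≤ A * |q₁| * (2 * M) * M ^ 3 + (A * |p₁|) * M * M ^ 3 := by rw [hdiv]; gcongr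
    _ ≤ 2 * ((|q₁| + |p₁|) * (M ^ 4) * A) := by
        have : 0 ≤ A * |p₁| * M ^ 4 := by positivity
        nlinarith
    _ ≤ 2 * ((|q₁| + |p₁|) * (2 * ((1 + q₂ ^ 2) * (1 + k₂ ^ 2) + (1 + p₂ ^ 2) * (1 + q₂ ^ 2) +
        (1 + p₂ ^ 2) * (1 + k₂ ^ 2))) * (A + B)) := by
        gcongr
        linarith
    _ = _ := by ring

/-- Trilinear estimate for lattice sequences in anisotropic weighted `ℓ²` spaces. -/
lemma summable_trilinear_lattice {b : ℤ × ℤ → ℝ} (hb : ∀ k, 0 ≤ b k)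
    (hX : Summable fun k : ℤ × ℤ => (1 + (k.1 : ℝ) ^ 2) * (1 + (k.2 : ℝ) ^ 2) * b k ^ 2)
    (hY : Summable fun k : ℤ × ℤ => (1 + (k.2 : ℝ) ^ 2) ^ 2 * b k ^ 2)
    (hV : Summable fun k : ℤ × ℤ => (1 + (k.1 : ℝ) ^ 2) * (1 + (k.2 : ℝ) ^ 2) ^ 2 * b k ^ 2)
    (hw : Summable invWeight) {ε : ℝ} (hε : 0 < ε) {t : (ℤ × ℤ) × (ℤ × ℤ) → ℝ}
    (ht0 : ∀ i, 0 ≤ t i)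
    (ht : ∀ i, t i ≤ (|(i.2.1 : ℝ)| + |((i.1 - i.2).1 : ℝ)|) *
      ((1 + (i.2.2 : ℝ) ^ 2) * (1 + (i.1.2 : ℝ) ^ 2) +
        (1 + ((i.1 - i.2).2 : ℝ) ^ 2) * (1 + (i.2.2 : ℝ) ^ 2) +
        (1 + ((i.1 - i.2).2 : ℝ) ^ 2) * (1 + (i.1.2 : ℝ) ^ 2)) *
      (b (i.1 - i.2) * b i.2 * b i.1)) :
    Summable t ∧ ∑' i, t i ≤ 6 * (ε * ((∑' k : ℤ × ℤ, (1 + (k.1 : ℝ) ^ 2) * (1 + (k.2 : ℝ) ^ 2) * b k ^ 2) *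
        ∑' k : ℤ × ℤ, (1 + (k.1 : ℝ) ^ 2) * (1 + (k.2 : ℝ) ^ 2) ^ 2 * b k ^ 2) +
      ε⁻¹ * ((∑' k : ℤ × ℤ, (1 + (k.2 : ℝ) ^ 2) ^ 2 * b k ^ 2) * ∑' k, invWeight k)) := by
  have key := fun σ τ υ ρ h1 h2 t ht0 ht => summable_trilinear (ι := (ℤ × ℤ) × (ℤ × ℤ)) hX hY hV hw
    (fun k => by positivity) (fun k => by positivity) (fun k => by positivity) invWeight_nonneg
    σ τ υ ρ h1 h2 (t := t) ht0 ht hε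
  have bnn : ∀ i : (ℤ × ℤ) × (ℤ × ℤ), 0 ≤ b (i.1 - i.2) * b i.2 * b i.1 :=
    fun i => mul_nonneg (mul_nonneg (hb _) (hb _)) (hb _)
  have comp : ∀ x R S : ℝ, 0 ≤ R → (1 + x ^ 2) * R = S → x ^ 2 * R ≤ S := by
    intro x R S hR h
    rw [← h]
    gcongr
    linarith
  have k1 := key (fun i => i.1 - i.2) (fun i => i.1) (fun i => i.2) (fun i => i.1 - i.2)
    (by rintro ⟨⟨k1, k2⟩, q1, q2⟩ ⟨⟨k1', k2'⟩, q1', q2'⟩ h; simp at h ⊢; omega)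
    (by rintro ⟨⟨k1, k2⟩, q1, q2⟩ ⟨⟨k1', k2'⟩, q1', q2'⟩ h; simp at h ⊢; omega)
    (fun i => |(i.2.1 : ℝ)| * ((1 + (i.2.2 : ℝ) ^ 2) * (1 + (i.1.2 : ℝ) ^ 2)) *
      (b (i.1 - i.2) * b i.2 * b i.1)) (fun i => mul_nonneg (by positivity) (bnn i))
    (fun i => by
      rw [mul_pow, mul_pow, sq_abs, mul_assoc]
      refine comp _ _ _ (by positivity) ?_
      unfold invWeight
      field_simp)
  have k2 := key (fun i => i.1) (fun i => i.1 - i.2) (fun i => i.2) (fun i => i.1)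
    (by rintro ⟨⟨k1, k2⟩, q1, q2⟩ ⟨⟨k1', k2'⟩, q1', q2'⟩ h; simp at h ⊢; omega)
    (by rintro ⟨⟨k1, k2⟩, q1, q2⟩ ⟨⟨k1', k2'⟩, q1', q2'⟩ h; simp at h ⊢; omega)
    (fun i => |(i.2.1 : ℝ)| * ((1 + ((i.1 - i.2).2 : ℝ) ^ 2) * (1 + (i.2.2 : ℝ) ^ 2)) *
      (b (i.1 - i.2) * b i.2 * b i.1)) (fun i => mul_nonneg (by positivity) (bnn i))
    (fun i => by
      rw [mul_pow, mul_pow, sq_abs, mul_assoc]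
      refine comp _ _ _ (by positivity) ?_
      unfold invWeight
      field_simp)
  have k3 := key (fun i => i.2) (fun i => i.1 - i.2) (fun i => i.1) (fun i => (i.1.1, i.2.2))
    (by rintro ⟨⟨k1, k2⟩, q1, q2⟩ ⟨⟨k1', k2'⟩, q1', q2'⟩ h; simp at h ⊢; omega)
    (by rintro ⟨⟨k1, k2⟩, q1, q2⟩ ⟨⟨k1', k2'⟩, q1', q2'⟩ h; simp at h ⊢; omega)
    (fun i => |(i.2.1 : ℝ)| * ((1 + ((i.1 - i.2).2 : ℝ) ^ 2) * (1 + (i.1.2 : ℝ) ^ 2)) *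
      (b (i.1 - i.2) * b i.2 * b i.1)) (fun i => mul_nonneg (by positivity) (bnn i))
    (fun i => by
      rw [mul_pow, mul_pow, sq_abs, mul_assoc]
      refine comp _ _ _ (by positivity) ?_
      unfold invWeight
      field_simp)
  have k4 := key (fun i => i.1) (fun i => i.2) (fun i => i.1 - i.2) (fun i => i.1)
    (by rintro ⟨⟨k1, k2⟩, q1, q2⟩ ⟨⟨k1', k2'⟩, q1', q2'⟩ h; simp at h ⊢; omega)
    (by rintro ⟨⟨k1, k2⟩, q1, q2⟩ ⟨⟨k1', k2'⟩, q1', q2'⟩ h; simp at h ⊢; omega)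
    (fun i => |((i.1 - i.2).1 : ℝ)| * ((1 + ((i.1 - i.2).2 : ℝ) ^ 2) * (1 + (i.2.2 : ℝ) ^ 2)) *
      (b (i.1 - i.2) * b i.2 * b i.1)) (fun i => mul_nonneg (by positivity) (bnn i))
    (fun i => by
      rw [mul_pow, mul_pow, sq_abs, mul_assoc]
      refine comp _ _ _ (by positivity) ?_
      unfold invWeight
      field_simp)
  have k5 := key (fun i => i.2) (fun i => i.1) (fun i => i.1 - i.2) (fun i => i.2)
    (by rintro ⟨⟨k1, k2⟩, q1, q2⟩ ⟨⟨k1', k2'⟩, q1', q2'⟩ h; simp at h ⊢; omega)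
    (by rintro ⟨⟨k1, k2⟩, q1, q2⟩ ⟨⟨k1', k2'⟩, q1', q2'⟩ h; simp at h ⊢; omega)
    (fun i => |((i.1 - i.2).1 : ℝ)| * ((1 + ((i.1 - i.2).2 : ℝ) ^ 2) * (1 + (i.1.2 : ℝ) ^ 2)) *
      (b (i.1 - i.2) * b i.2 * b i.1)) (fun i => mul_nonneg (by positivity) (bnn i))
    (fun i => by
      rw [mul_pow, mul_pow, sq_abs, mul_assoc]
      refine comp _ _ _ (by positivity) ?_
      unfold invWeight
      field_simp)
  have k6 := key (fun i => i.1 - i.2) (fun i => i.2) (fun i => i.1)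
    (fun i => (i.1.1, (i.1 - i.2).2))
    (by rintro ⟨⟨k1, k2⟩, q1, q2⟩ ⟨⟨k1', k2'⟩, q1', q2'⟩ h; simp at h ⊢; omega)
    (by rintro ⟨⟨k1, k2⟩, q1, q2⟩ ⟨⟨k1', k2'⟩, q1', q2'⟩ h; simp at h ⊢; omega)
    (fun i => |((i.1 - i.2).1 : ℝ)| * ((1 + (i.2.2 : ℝ) ^ 2) * (1 + (i.1.2 : ℝ) ^ 2)) *
      (b (i.1 - i.2) * b i.2 * b i.1)) (fun i => mul_nonneg (by positivity) (bnn i))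
    (fun i => by
      rw [mul_pow, mul_pow, sq_abs, mul_assoc]
      refine comp _ _ _ (by positivity) ?_
      unfold invWeight
      field_simp)
  have hs := ((((k1.1.hasSum.add k2.1.hasSum).add k3.1.hasSum).add k4.1.hasSum).add
    k5.1.hasSum).add k6.1.hasSum
  have hst : Summable t :=
    Summable.of_nonneg_of_le ht0 (fun i => (ht i).trans (le_of_eq (by ring))) hs.summable
  refine ⟨hst, (hasSum_le (fun i => (ht i).trans (le_of_eq (by ring))) hst.hasSum hs).trans ?_⟩
  linarith [k1.2, k2.2, k3.2, k4.2, k5.2, k6.2]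

/-! ### The trilinear form in Fourier variables -/

/-- Smooth vector fields on the torus. -/
structure SmoothPerV (u : ℝ × ℝ → ℝ × ℝ) : Prop where
  fst : SmoothPer (comp1 u)
  snd : SmoothPer (comp2 u)

lemma SmoothPerV.of_smoothV {u : ℝ × ℝ → ℝ × ℝ} (hs : SmoothV u) (hper : PerV u) : SmoothPerV u :=
  ⟨⟨hs.fst, hper.1⟩, ⟨hs.snd, hper.2⟩⟩

lemma SmoothPerV.advect {u v : ℝ × ℝ → ℝ × ℝ} (hu : SmoothPerV u) (hv : SmoothPerV v) :
    SmoothPerV (advect u v) :=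
  ⟨(hu.fst.mul hv.fst.pd1).add (hu.snd.mul hv.fst.pd2),
    (hu.fst.mul hv.snd.pd1).add (hu.snd.mul hv.snd.pd2)⟩

lemma DivFree.fc_eq_zero {u : ℝ × ℝ → ℝ × ℝ} (hu : SmoothPerV u) (hdiv : DivFree u) (k : ℤ × ℤ) :
    (k.1 : ℂ) * fc (comp1 u) k + k.2 * fc (comp2 u) k = 0 := by
  have h := fc_add hu.fst.pd1 hu.snd.pd2 k
  rw [(fc_pd hu.fst k).1, (fc_pd hu.snd k).2, funext hdiv] at h
  have h0 : fc (fun _ => 0) k = 0 := by simp [fc, fcC]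
  rw [h0] at h
  have h1 : Complex.I * (k.1 * fc (comp1 u) k + k.2 * fc (comp2 u) k) = 0 := by
    rw [h]
    ring
  exact (mul_eq_zero.1 h1).resolve_left Complex.I_ne_zero

lemma hasSum_fc_transport {f g v : ℝ × ℝ → ℝ} (hf : SmoothPer f) (hg : SmoothPer g)
    (hv : SmoothPer v) (k : ℤ × ℤ) :
    HasSum (fun q => Complex.I * (fc f (k - q) * q.1 + fc g (k - q) * q.2) * fc v q)
      (fc (fun x => f x * pd1 v x + g x * pd2 v x) k) := by
  rw [fc_add (hf.mul hv.pd1) (hg.mul hv.pd2)]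
  convert (hasSum_fc_mul hf hv.pd1 k).add (hasSum_fc_mul hg hv.pd2 k) using 2 with q
  rw [(fc_pd hv q).1, (fc_pd hv q).2]
  ring

section DyadicPartition

variable {χ θ : ℝ → ℝ}

lemma IsDyadicPartition.summable_norm_block (hp : IsDyadicPartition χ θ) (j : ℤ)
    {f : ℝ × ℝ → ℝ} (hf : SmoothPer f) :
    Summable fun k : ℤ × ℤ => ‖(blockSymb χ θ j k.2 : ℂ) * fc f k‖ := by
  obtain ⟨C, hC⟩ := hp.exists_bound_blockSymb
  refine Summable.of_nonneg_of_le (fun _ => norm_nonneg _) (fun k => ?_)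
    ((summable_norm_fc hf).mul_left C)
  rw [norm_mul, Complex.norm_real, Real.norm_eq_abs]
  gcongr
  exact hC _ _

lemma IsDyadicPartition.hasSum_ipCV (hp : IsDyadicPartition χ θ) (j : ℤ)
    {f g : ℝ × ℝ → ℝ × ℝ} (hf : SmoothPerV f) (hg : SmoothPerV g) :
    HasSum (fun k : ℤ × ℤ => ((2 * π) ^ 2 : ℂ) * ((blockSymb χ θ j k.2 : ℂ) ^ 2 *
      (fc (comp1 f) k * (starRingEnd ℂ) (fc (comp1 g) k) +
        fc (comp2 f) k * (starRingEnd ℂ) (fc (comp2 g) k))))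
      (ipCV (LPV χ θ j f) (LPV χ θ j g)) := by
  have h1 := hp.summable_norm_block j hf.fst
  have h2 := hp.summable_norm_block j hf.snd
  have h3 := hp.summable_norm_block j hg.fst
  have h4 := hp.summable_norm_block j hg.snd
  have h := (hasSum_parseval h1 h3).add (hasSum_parseval h2 h4)
  rw [← integral_add] at h
  · convert h using 2 with k
    · simp only [map_mul, Complex.conj_ofReal]
      ring
    · rfl
  · exact integrableOn_Q2 ((continuous_series h1).mul
      (Complex.continuous_conj.comp (continuous_series h3)))
  · exact integrableOn_Q2 ((continuous_series h2).mul
      (Complex.continuous_conj.comp (continuous_series h4)))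

lemma trilinearSymb_neg_swap {a b : ℤ × ℤ → ℂ} (ha : ∀ k, a (-k) = (starRingEnd ℂ) (a k))
    (hb : ∀ k, b (-k) = (starRingEnd ℂ) (b k))
    (hdiv : ∀ k : ℤ × ℤ, (k.1 : ℂ) * a k + k.2 * b k = 0) (i : (ℤ × ℤ) × (ℤ × ℤ)) :
    trilinearSymb a b (-i.2, -i.1) = -trilinearSymb a b i := by
  have h := hdiv (i.1 - i.2)
  simp only [trilinearSymb, neg_sub_neg, ha, hb, Complex.conj_conj, Prod.fst_neg, Prod.snd_neg]
  simp only [Prod.fst_sub, Prod.snd_sub] at h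
  push_cast at h ⊢
  linear_combination (-Complex.I * (a i.2 * (starRingEnd ℂ) (a i.1) +
    b i.2 * (starRingEnd ℂ) (b i.1))) * h

lemma summable_norm_trilinearSymb {f g : ℝ × ℝ → ℝ} (hf : SmoothPer f) (hg : SmoothPer g) :
    Summable fun i => ‖trilinearSymb (fc f) (fc g) i‖ := by
  obtain ⟨C, hC⟩ := norm_fc_le f
  obtain ⟨D, hD⟩ := norm_fc_le g
  have h1 := (summable_weight_fc 1 1 hf).add (summable_weight_fc 1 1 hg)
  have h0 := (summable_norm_fc hf).add (summable_norm_fc hg)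
  refine Summable.of_nonneg_of_le (fun _ => norm_nonneg _) (fun i => ?_)
    ((h0.mul_of_nonneg h1 (fun _ => by positivity) (fun _ => by positivity)).mul_left (C + D))
  refine (norm_trilinearSymb_le _ _ i).trans ?_
  have hx : |(i.2.1 : ℝ)| ≤ (1 + (i.2.1 : ℝ) ^ 2) * (1 + (i.2.2 : ℝ) ^ 2) := by
    have : |(i.2.1 : ℝ)| ≤ 1 + (i.2.1 : ℝ) ^ 2 := by
      rw [← sq_abs]
      nlinarith [sq_nonneg (|(i.2.1 : ℝ)| - 1)]
    nlinarith [sq_nonneg (i.2.2 : ℝ), mul_nonneg (sq_nonneg (i.2.1 : ℝ)) (sq_nonneg (i.2.2 : ℝ))]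
  have hy : |(i.2.2 : ℝ)| ≤ (1 + (i.2.1 : ℝ) ^ 2) * (1 + (i.2.2 : ℝ) ^ 2) := by
    have : |(i.2.2 : ℝ)| ≤ 1 + (i.2.2 : ℝ) ^ 2 := by
      rw [← sq_abs]
      nlinarith [sq_nonneg (|(i.2.2 : ℝ)| - 1)]
    nlinarith [sq_nonneg (i.2.1 : ℝ), mul_nonneg (sq_nonneg (i.2.1 : ℝ)) (sq_nonneg (i.2.2 : ℝ))]
  calc _ ≤ (C * ((1 + (i.2.1 : ℝ) ^ 2) * (1 + (i.2.2 : ℝ) ^ 2)) +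
        D * ((1 + (i.2.1 : ℝ) ^ 2) * (1 + (i.2.2 : ℝ) ^ 2))) *
        ((‖fc f i.2‖ + ‖fc g i.2‖) * (‖fc f i.1‖ + ‖fc g i.1‖)) := by
        have hC0 := (norm_nonneg _).trans (hC 0)
        have hD0 := (norm_nonneg _).trans (hD 0)
        gcongr
        · exact hC _
        · exact hD _
    _ = _ := by ring

/-- The cancellation coming from the divergence-free condition: only the commutator of the
Littlewood–Paley block contributes to the energy. -/
lemma IsDyadicPartition.norm_ipCV_advect_le (hp : IsDyadicPartition χ θ) (j : ℤ)
    {u : ℝ × ℝ → ℝ × ℝ} (hu : SmoothPerV u) (hdiv : DivFree u) :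
    Summable (fun i : (ℤ × ℤ) × (ℤ × ℤ) =>
      |blockSymb χ θ j i.1.2 ^ 2 - blockSymb χ θ j i.2.2 ^ 2| *
        ‖trilinearSymb (fc (comp1 u)) (fc (comp2 u)) i‖) ∧
    ‖ipCV (LPV χ θ j (advect u u)) (LPV χ θ j u)‖ ≤ 2 * π ^ 2 *
      ∑' i : (ℤ × ℤ) × (ℤ × ℤ), |blockSymb χ θ j i.1.2 ^ 2 - blockSymb χ θ j i.2.2 ^ 2| *
        ‖trilinearSymb (fc (comp1 u)) (fc (comp2 u)) i‖ := by
  set G := trilinearSymb (fc (comp1 u)) (fc (comp2 u)) with hG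
  have hGs : Summable fun i => ‖G i‖ := summable_norm_trilinearSymb hu.fst hu.snd
  obtain ⟨C, hC⟩ := hp.exists_bound_blockSymb
  have hC2 : ∀ x, |blockSymb χ θ j x ^ 2| ≤ C ^ 2 := fun x => by
    rw [abs_pow]
    gcongr
    exact hC _ _
  have hsum : Summable fun i : (ℤ × ℤ) × (ℤ × ℤ) => (blockSymb χ θ j i.1.2 : ℂ) ^ 2 * G i := by
    refine Summable.of_norm_bounded (hGs.mul_left (C ^ 2)) fun i => ?_
    rw [norm_mul, ← Complex.ofReal_pow, Complex.norm_real, Real.norm_eq_abs]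
    gcongr
    exact hC2 _
  have hfib := hsum.hasSum.prod_fiberwise (g := fun k : ℤ × ℤ => (blockSymb χ θ j k.2 : ℂ) ^ 2 *
      (fc (comp1 (advect u u)) k * (starRingEnd ℂ) (fc (comp1 u) k) +
        fc (comp2 (advect u u)) k * (starRingEnd ℂ) (fc (comp2 u) k))) fun k => by
    have h1 := (hasSum_fc_transport hu.fst hu.snd hu.fst k).mul_right
      ((starRingEnd ℂ) (fc (comp1 u) k))
    have h2 := (hasSum_fc_transport hu.fst hu.snd hu.snd k).mul_right
      ((starRingEnd ℂ) (fc (comp2 u) k))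
    refine HasSum.congr_fun ((h1.add h2).mul_left ((blockSymb χ θ j k.2 : ℂ) ^ 2)) fun q => ?_
    simp only [hG, trilinearSymb]
    ring
  have hip := (hp.hasSum_ipCV j (hu.advect hu) hu).unique (hfib.mul_left ((2 * π) ^ 2 : ℂ))
  let e : (ℤ × ℤ) × (ℤ × ℤ) ≃ (ℤ × ℤ) × (ℤ × ℤ) :=
    (Equiv.prodComm _ _).trans ((Equiv.neg _).prodCongr (Equiv.neg _))
  have hswap := e.hasSum_iff.2 hsum.hasSum
  have hcomm := hsum.hasSum.add hswap
  have hterm : ∀ i : (ℤ × ℤ) × (ℤ × ℤ), (blockSymb χ θ j i.1.2 : ℂ) ^ 2 * G i +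
      ((fun i : (ℤ × ℤ) × (ℤ × ℤ) => (blockSymb χ θ j i.1.2 : ℂ) ^ 2 * G i) ∘ e) i =
      ((blockSymb χ θ j i.1.2 ^ 2 - blockSymb χ θ j i.2.2 ^ 2 : ℝ) : ℂ) * G i := by
    intro i
    have h := trilinearSymb_neg_swap (fc_neg (comp1 u)) (fc_neg (comp2 u))
      (hdiv.fc_eq_zero hu) i
    simp only [Function.comp_apply, e, Equiv.trans_apply, Equiv.prodComm_apply,
      Equiv.prodCongr_apply, Prod.map, Prod.swap, Equiv.neg_apply, hG, h, Prod.snd_neg]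
    rw [Int.cast_neg, blockSymb_neg]
    push_cast
    ring
  simp_rw [hterm] at hcomm
  have hs : Summable fun i : (ℤ × ℤ) × (ℤ × ℤ) =>
      |blockSymb χ θ j i.1.2 ^ 2 - blockSymb χ θ j i.2.2 ^ 2| * ‖G i‖ := by
    refine Summable.of_nonneg_of_le (fun i => by positivity) (fun i => ?_)
      (hGs.mul_left (C ^ 2 + C ^ 2))
    gcongr
    exact (abs_sub _ _).trans (add_le_add (hC2 _) (hC2 _))
  refine ⟨hs, ?_⟩
  have hle := hcomm.norm_le_of_bounded hs.hasSum fun i => by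
    rw [norm_mul, Complex.norm_real, Real.norm_eq_abs]
  rw [← two_mul, norm_mul, Complex.norm_ofNat] at hle
  rw [hip, norm_mul]
  have hpi : ‖((2 * π) ^ 2 : ℂ)‖ = 4 * π ^ 2 := by
    rw [norm_pow, norm_mul, Complex.norm_ofNat, Complex.norm_real, Real.norm_eq_abs,
      abs_of_pos Real.pi_pos]
    ring
  rw [hpi]
  nlinarith [sq_nonneg π]

end DyadicPartition

/-! ### Sobolev norms -/

/-- The sum of the moduli of the Fourier coefficients of the components of a vector field. -/
def fcNormV (u : ℝ × ℝ → ℝ × ℝ) (k : ℤ × ℤ) : ℝ := ‖fc (comp1 u) k‖ + ‖fc (comp2 u) k‖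

lemma HNV_sq (s s' : ℝ) (u : ℝ × ℝ → ℝ × ℝ) :
    HNV s s' u ^ 2 = HSq s s' (comp1 u) + HSq s s' (comp2 u) := by
  have h : ∀ f, 0 ≤ HSq s s' f := fun f => tsum_nonneg fun k => by
    unfold aw
    positivity
  exact Real.sq_sqrt (add_nonneg (h _) (h _))

lemma hasSum_HSq (m n : ℕ) {f : ℝ × ℝ → ℝ} (hf : SmoothPer f) :
    HasSum (fun k : ℤ × ℤ => (1 + (k.1 : ℝ) ^ 2) ^ m * (1 + (k.2 : ℝ) ^ 2) ^ n * ‖fc f k‖ ^ 2)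
      (HSq m n f) := by
  simpa only [HSq, aw, Real.rpow_natCast] using (summable_weight_fc_sq m n hf).hasSum

lemma HSq_succ (m n : ℕ) {f : ℝ × ℝ → ℝ} (hf : SmoothPer f) :
    HSq (m + 1 : ℕ) n f = HSq m n f + HSq m n (pd1 f) := by
  refine (hasSum_HSq (m + 1) n hf).unique
    (HasSum.congr_fun ((hasSum_HSq m n hf).add (hasSum_HSq m n hf.pd1)) fun k => ?_)
  rw [(fc_pd hf k).1, norm_mul, norm_mul, Complex.norm_I, Complex.norm_intCast, mul_pow, mul_pow,
    sq_abs]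
  ring

lemma HNV_succ_sq (m n : ℕ) {u : ℝ × ℝ → ℝ × ℝ} (hu : SmoothPerV u) :
    HNV (m + 1 : ℕ) n u ^ 2 = HNV m n u ^ 2 + HNV m n (pd1V u) ^ 2 := by
  rw [HNV_sq, HNV_sq, HNV_sq, HSq_succ m n hu.fst, HSq_succ m n hu.snd]
  exact add_add_add_comm _ _ _ _

lemma tsum_fcNormV_sq_le (m n : ℕ) {u : ℝ × ℝ → ℝ × ℝ} (hu : SmoothPerV u) :
    (Summable fun k : ℤ × ℤ =>
      (1 + (k.1 : ℝ) ^ 2) ^ m * (1 + (k.2 : ℝ) ^ 2) ^ n * fcNormV u k ^ 2) ∧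
    ∑' k : ℤ × ℤ, (1 + (k.1 : ℝ) ^ 2) ^ m * (1 + (k.2 : ℝ) ^ 2) ^ n * fcNormV u k ^ 2 ≤
      2 * HNV m n u ^ 2 := by
  have h := ((hasSum_HSq m n hu.fst).add (hasSum_HSq m n hu.snd)).mul_left 2
  rw [← HNV_sq] at h
  have hle : ∀ k : ℤ × ℤ, (1 + (k.1 : ℝ) ^ 2) ^ m * (1 + (k.2 : ℝ) ^ 2) ^ n * fcNormV u k ^ 2 ≤
      2 * ((1 + (k.1 : ℝ) ^ 2) ^ m * (1 + (k.2 : ℝ) ^ 2) ^ n * ‖fc (comp1 u) k‖ ^ 2 +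
        (1 + (k.1 : ℝ) ^ 2) ^ m * (1 + (k.2 : ℝ) ^ 2) ^ n * ‖fc (comp2 u) k‖ ^ 2) := fun k => by
    rw [← mul_add, mul_left_comm]
    gcongr
    exact add_sq_le
  have hs := Summable.of_nonneg_of_le (fun k => by positivity) hle h.summable
  exact ⟨hs, hasSum_le hle hs.hasSum h⟩

lemma sum_mul_le_mul_tsum {ι κ : Type*} (s : Finset ι) {a N : ι → ℝ} {F : ι → κ → ℝ} {T : κ → ℝ}
    {c : ℝ} (ha : ∀ j, 0 ≤ a j) (hc : 0 ≤ c) (hF : ∀ j, Summable (F j))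
    (hN : ∀ j, N j ≤ c * ∑' i, F j i) (hT : Summable T) (h : ∀ i, ∑ j ∈ s, a j * F j i ≤ T i) :
    ∑ j ∈ s, a j * N j ≤ c * ∑' i, T i := by
  calc _ ≤ ∑ j ∈ s, a j * (c * ∑' i, F j i) :=
        Finset.sum_le_sum fun j _ => mul_le_mul_of_nonneg_left (hN j) (ha j)
    _ = c * ∑' i, ∑ j ∈ s, a j * F j i := by
        rw [Summable.tsum_finsetSum fun j _ => (hF j).mul_left _, Finset.mul_sum]
        refine Finset.sum_congr rfl fun j _ => ?_
        rw [tsum_mul_left, mul_left_comm]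
    _ ≤ _ := mul_le_mul_of_nonneg_left
        (Summable.tsum_le_tsum h (summable_sum fun j _ => (hF j).mul_left _) hT) hc

/-- The trilinear lattice term that dominates the nonlinear form of a divergence-free field. -/
def latticeTerm (u : ℝ × ℝ → ℝ × ℝ) (i : (ℤ × ℤ) × (ℤ × ℤ)) : ℝ :=
  (|(i.2.1 : ℝ)| + |((i.1 - i.2).1 : ℝ)|) *
    ((1 + (i.2.2 : ℝ) ^ 2) * (1 + (i.1.2 : ℝ) ^ 2) +
      (1 + ((i.1 - i.2).2 : ℝ) ^ 2) * (1 + (i.2.2 : ℝ) ^ 2) +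
      (1 + ((i.1 - i.2).2 : ℝ) ^ 2) * (1 + (i.1.2 : ℝ) ^ 2)) *
    (fcNormV u (i.1 - i.2) * fcNormV u i.2 * fcNormV u i.1)

lemma fcNormV_nonneg (u : ℝ × ℝ → ℝ × ℝ) (k : ℤ × ℤ) : 0 ≤ fcNormV u k :=
  add_nonneg (norm_nonneg _) (norm_nonneg _)

lemma mul_norm_trilinearSymb_le {u : ℝ × ℝ → ℝ × ℝ} (hu : SmoothPerV u) (hdiv : DivFree u)
    {C S : ℝ} (hC : 0 ≤ C) (i : (ℤ × ℤ) × (ℤ × ℤ))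
    (hS : S ≤ C * (|(i.1.2 : ℝ) - i.2.2| * (max 1 (max |(i.1.2 : ℝ)| |(i.2.2 : ℝ)|)) ^ 3)) :
    S * ‖trilinearSymb (fc (comp1 u)) (fc (comp2 u)) i‖ ≤ 4 * C * latticeTerm u i := by
  have h2 := hdiv.fc_eq_zero hu (i.1 - i.2)
  have h3 : ‖fc (comp2 u) (i.1 - i.2)‖ * |((i.1 - i.2).2 : ℝ)| =
      ‖fc (comp1 u) (i.1 - i.2)‖ * |((i.1 - i.2).1 : ℝ)| := by
    have := congrArg norm (eq_neg_of_add_eq_zero_left h2)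
    rw [norm_neg, norm_mul, norm_mul, Complex.norm_intCast, Complex.norm_intCast] at this
    linarith
  have h4 := anisotropic_pointwise_le (q₁ := i.2.1) (q₂ := i.2.2) (k₂ := i.1.2)
    (norm_nonneg _) (norm_nonneg _) h3 (by simp)
  have h5 : ((i.1 - i.2).2 : ℝ) = i.1.2 - i.2.2 := by simp
  calc _ ≤ C * (|(i.1.2 : ℝ) - i.2.2| * (max 1 (max |(i.1.2 : ℝ)| |(i.2.2 : ℝ)|)) ^ 3) *
        ((‖fc (comp1 u) (i.1 - i.2)‖ * |(i.2.1 : ℝ)| +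
          ‖fc (comp2 u) (i.1 - i.2)‖ * |(i.2.2 : ℝ)|) * (fcNormV u i.2 * fcNormV u i.1)) :=
        mul_le_mul hS (norm_trilinearSymb_le _ _ i) (norm_nonneg _) (by positivity)
    _ = C * (((‖fc (comp1 u) (i.1 - i.2)‖ * |(i.2.1 : ℝ)| +
          ‖fc (comp2 u) (i.1 - i.2)‖ * |(i.2.2 : ℝ)|) * (|((i.1 - i.2).2 : ℝ)| *
          (max 1 (max |(i.1.2 : ℝ)| |(i.2.2 : ℝ)|)) ^ 3)) *
          (fcNormV u i.2 * fcNormV u i.1)) := by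
        rw [h5]
        ring
    _ ≤ _ := mul_le_mul_of_nonneg_left (mul_le_mul_of_nonneg_right h4
        (mul_nonneg (fcNormV_nonneg u _) (fcNormV_nonneg u _))) hC
    _ = 4 * C * latticeTerm u i := by
        simp only [latticeTerm, fcNormV]
        ring

section DyadicPartition

variable {χ θ : ℝ → ℝ}

lemma IsDyadicPartition.exists_sum_norm_ipCV_le (hp : IsDyadicPartition χ θ) :
    ∃ K : ℝ, 0 ≤ K ∧ ∀ (u : ℝ × ℝ → ℝ × ℝ), SmoothPerV u → DivFree u →
      ∀ (s : Finset {j : ℤ // -1 ≤ j}) (ε : ℝ), 0 < ε →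
      ∑ j ∈ s, (2 : ℝ) ^ (4 * (j.1 : ℝ)) * ‖ipCV (LPV χ θ j.1 (advect u u)) (LPV χ θ j.1 u)‖ ≤
        K * (ε * (HNV 1 1 u ^ 2 * (HNV 0 2 u ^ 2 + HNV 0 2 (pd1V u) ^ 2)) +
          ε⁻¹ * HNV 0 2 u ^ 2) := by
  obtain ⟨C, hC0, hC⟩ := hp.exists_sum_blockSymb_sq_sub_le
  have hw0 : 0 ≤ ∑' k, invWeight k := tsum_nonneg invWeight_nonneg
  set w := ∑' k, invWeight k with hw
  refine ⟨2 * π ^ 2 * (4 * C) * 6 * (4 + 2 * w), by positivity, fun u hu hdiv s ε hε => ?_⟩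
  obtain ⟨X1, X2⟩ := tsum_fcNormV_sq_le 1 1 hu
  obtain ⟨Y1, Y2⟩ := tsum_fcNormV_sq_le 0 2 hu
  obtain ⟨V1, V2⟩ := tsum_fcNormV_sq_le 1 2 hu
  have hV := HNV_succ_sq 0 2 hu
  simp only [zero_add, pow_zero, pow_one, one_mul, Nat.cast_one, Nat.cast_zero, Nat.cast_ofNat]
    at X1 X2 Y1 Y2 V1 V2 hV
  rw [hV] at V2
  obtain ⟨hTs, hTle⟩ := summable_trilinear_lattice (fcNormV_nonneg u) X1 Y1 V1 summable_inv_weight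
    hε (t := latticeTerm u)
    (fun i => mul_nonneg (by positivity) (mul_nonneg (mul_nonneg (fcNormV_nonneg u _)
      (fcNormV_nonneg u _)) (fcNormV_nonneg u _))) fun i => le_rfl
  have hN := fun j : {j : ℤ // -1 ≤ j} => hp.norm_ipCV_advect_le j.1 hu hdiv
  have hsum := sum_mul_le_mul_tsum s (a := fun j => (2 : ℝ) ^ (4 * (j.1 : ℝ)))
    (T := fun i => 4 * C * latticeTerm u i) (fun j => by positivity) (by positivity)
    (fun j => (hN j).1) (fun j => (hN j).2) (hTs.mul_left _) fun i => by
      simp only [← mul_assoc, ← Finset.sum_mul]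
      exact mul_norm_trilinearSymb_le hu hdiv hC0 i (hC s i.1.2 i.2.2 _ (le_max_left _ _)
        ((le_max_left _ _).trans (le_max_right _ _)) ((le_max_right _ _).trans (le_max_right _ _)))
  rw [tsum_mul_left] at hsum
  calc _ ≤ 2 * π ^ 2 * (4 * C * ∑' i, latticeTerm u i) := hsum
    _ ≤ 2 * π ^ 2 * (4 * C * (6 * (ε * ((2 * HNV 1 1 u ^ 2) *
          (2 * (HNV 0 2 u ^ 2 + HNV 0 2 (pd1V u) ^ 2))) + ε⁻¹ * (2 * HNV 0 2 u ^ 2 * w)))) := by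
        gcongr
        refine hTle.trans ?_
        have : 0 ≤ ∑' k : ℤ × ℤ, (1 + (k.1 : ℝ) ^ 2) * (1 + (k.2 : ℝ) ^ 2) ^ 2 * fcNormV u k ^ 2 :=
          tsum_nonneg fun k => by positivity
        gcongr
    _ = 2 * π ^ 2 * (4 * C) * 6 *
        (4 * (ε * (HNV 1 1 u ^ 2 * (HNV 0 2 u ^ 2 + HNV 0 2 (pd1V u) ^ 2))) +
          2 * w * (ε⁻¹ * HNV 0 2 u ^ 2)) := by ring
    _ ≤ 2 * π ^ 2 * (4 * C) * 6 *
        ((4 + 2 * w) * (ε * (HNV 1 1 u ^ 2 * (HNV 0 2 u ^ 2 + HNV 0 2 (pd1V u) ^ 2))) +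
          (4 + 2 * w) * (ε⁻¹ * HNV 0 2 u ^ 2)) := by
        gcongr <;> linarith
    _ = _ := by ring

end DyadicPartition

/-- for `0 < α < 1/2` there is `C_α > 0` such that for every smooth
divergence-free `u`,
`Σ_{k≥−1} 2^{4k} |⟨Δ^v_k(u·∇u), Δ^v_k u⟩| ≤ α ‖∂₁u‖²_{H^{0,2}} + C_α (1 + ‖u‖²_{H^{0,1}})(1 + ‖u‖²_{H^{1,1}}) ‖u‖²_{H^{0,2}}`. -/
theorem nonlinear_LP_H02_estimate (χ θ : ℝ → ℝ) (hp : IsDyadicPartition χ θ)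
    (α : ℝ) (hα0 : 0 < α) (hα : α < 1/2) :
    ∃ C > 0, ∀ u : ℝ × ℝ → ℝ × ℝ, SmoothV u → PerV u → DivFree u →
      (∑' k : {j : ℤ // -1 ≤ j}, (2 : ℝ) ^ (4 * (k.1 : ℝ)) *
          ‖ipCV (LPV χ θ k.1 (advect u u)) (LPV χ θ k.1 u)‖) ≤
        α * HNV 0 2 (pd1V u) ^ 2 +
          C * (1 + HNV 0 1 u ^ 2) * (1 + HNV 1 1 u ^ 2) * HNV 0 2 u ^ 2 := by
  obtain ⟨K, hK0, hK⟩ := hp.exists_sum_norm_ipCV_le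
  refine ⟨α + K * ((K + 1) / α), by positivity, fun u hs hper hdiv => ?_⟩
  refine Real.tsum_le_of_sum_le (fun j => by positivity) fun s => ?_
  have hB := sq_nonneg (HNV 1 1 u)
  have hY := sq_nonneg (HNV 0 2 u)
  have hZ := sq_nonneg (HNV 0 2 (pd1V u))
  have hE := sq_nonneg (HNV 0 1 u)
  refine (hK u (.of_smoothV hs hper) hdiv s (α / (K + 1) / (1 + HNV 1 1 u ^ 2))
    (by positivity)).trans ?_
  generalize HNV 1 1 u ^ 2 = B at *
  generalize HNV 0 2 u ^ 2 = Y at *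
  generalize HNV 0 2 (pd1V u) ^ 2 = Z at *
  generalize HNV 0 1 u ^ 2 = E at *
  have h1 : K * (α / (K + 1) / (1 + B) * B) ≤ α := by
    rw [div_div, div_mul_eq_mul_div, ← mul_div_assoc, div_le_iff₀ (by positivity)]
    nlinarith [mul_nonneg hK0 hα0.le, mul_nonneg hα0.le hB]
  calc _ = K * (α / (K + 1) / (1 + B) * B) * (Y + Z) + K * ((K + 1) / α) * (1 + B) * Y := by
        rw [inv_div, div_div_eq_mul_div]
        ring
    _ ≤ α * (Y + Z) + K * ((K + 1) / α) * (1 + B) * Y := by gcongr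
    _ ≤ α * Z + (α + K * ((K + 1) / α)) * 1 * (1 + B) * Y := by
        nlinarith [mul_nonneg hα0.le (mul_nonneg hB hY)]
    _ ≤ _ := by
        gcongr
        linarith

end Aniso
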